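/- Let Q0 be a cube in ℝ^d, 1 < p < ∞, 0 < r ≤ ∞, and λ > 0. The inequality ∫_0^{t(1−log t)^{−λ}} (u^{1/p} ((f − f_{Q0})^*(u))^r du/u ≤ C ∫_0^{t} (u^{1/p} ((f^#_{Q0})^*(u))^r du/u, valid for all f ∈ L_{p,r}(Q0) and all t ∈ (0,1) with C independent of f and t, holds if and only if λ ≥ p. -/

import Mathlib

open MeasureTheory ENNReal Set Filter

noncomputable section

abbrev Euc (d : ℕ) := EuclideanSpace ℝ (Fin d)

/-- Non-increasing rearrangement of an `ℝ≥0∞`-valued function w.r.t. a measure. -/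
def rearr {α : Type*} [MeasurableSpace α] (μ : Measure α) (g : α → ℝ≥0∞) (t : ℝ) : ℝ≥0∞ :=
  sInf {l : ℝ≥0∞ | μ {x | l < g x} ≤ ENNReal.ofReal t}

/-- Non-increasing rearrangement of a real-valued function. -/
def rearrR {α : Type*} [MeasurableSpace α] (μ : Measure α) (f : α → ℝ) (t : ℝ) : ℝ≥0∞ :=
  rearr μ (fun x => ENNReal.ofReal |f x|) t

/-- The maximal function `f^{**}(t) = t⁻¹ ∫_0^t f^*`. -/
def rearrStar {α : Type*} [MeasurableSpace α] (μ : Measure α) (f : α → ℝ) (t : ℝ) : ℝ≥0∞ :=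
  (ENNReal.ofReal t)⁻¹ * ∫⁻ s in Set.Ioo (0:ℝ) t, rearrR μ f s

/-- `(∫_I g(t)^q dt/t)^{1/q}`, with the usual sup modification when `q = ∞`. -/
def qnorm (q : ℝ≥0∞) (I : Set ℝ) (g : ℝ → ℝ≥0∞) : ℝ≥0∞ :=
  if q = ∞ then ⨆ t ∈ I, g t
  else (∫⁻ t in I, g t ^ q.toReal / ENNReal.ofReal t) ^ (1 / q.toReal)

/-- `∫_I g(t)^q dt/t` (no outer power), with the sup modification when `q = ∞`. -/
def qint (q : ℝ≥0∞) (I : Set ℝ) (g : ℝ → ℝ≥0∞) : ℝ≥0∞ :=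
  if q = ∞ then ⨆ t ∈ I, g t
  else ∫⁻ t in I, g t ^ q.toReal / ENNReal.ofReal t

/-- Lorentz quasinorm `(∫_I (t^{1/p} f^*(t))^q dt/t)^{1/q}`. -/
def lorentz {α : Type*} [MeasurableSpace α] (μ : Measure α) (f : α → ℝ)
    (p : ℝ) (q : ℝ≥0∞) (I : Set ℝ) : ℝ≥0∞ :=
  qnorm q I (fun t => ENNReal.ofReal (t ^ (1 / p)) * rearrR μ f t)

/-- The cube with lower-left corner `a` and side length `l`. -/
def cubeSet {d : ℕ} (a : Fin d → ℝ) (l : ℝ) : Set (Euc d) :=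
  {x | ∀ i, a i ≤ x i ∧ x i ≤ a i + l}

/-- Cubes in `ℝ^d` with sides parallel to the coordinate axes. -/
def IsCube {d : ℕ} (Q : Set (Euc d)) : Prop := ∃ a l, 0 < l ∧ Q = cubeSet a l

/-- The sharp maximal function `f^{#}` on `ℝ^d`. -/
def sharp {d : ℕ} (f : Euc d → ℝ) (x : Euc d) : ℝ≥0∞ :=
  ⨆ Q ∈ {Q : Set (Euc d) | IsCube Q ∧ x ∈ Q},
    ENNReal.ofReal (⨍ y in Q, |f y - ⨍ z in Q, f z|)

/-- The local sharp maximal function `f^{#}_{Q_0;μ}`. -/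
def sharpLocal {d : ℕ} (μ : Measure (Euc d)) (Q0 : Set (Euc d)) (f : Euc d → ℝ)
    (x : Euc d) : ℝ≥0∞ :=
  ⨆ Q ∈ {Q : Set (Euc d) | IsCube Q ∧ x ∈ Q ∧ Q ⊆ Q0},
    ENNReal.ofReal (⨍ y in Q, |f y - ⨍ z in Q, f z ∂μ| ∂μ)

def diffOp {d : ℕ} (h : Euc d) (f : Euc d → ℝ) : Euc d → ℝ := fun x => f (x + h) - f x

/-- The iterated difference `Δ_h^k f`. -/
def iterDiff {d : ℕ} (k : ℕ) (h : Euc d) (f : Euc d → ℝ) : Euc d → ℝ := (diffOp h)^[k] f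

/-- The modulus of smoothness `ω_k(f,t)_{p,q}` on `ℝ^d`. -/
def modulus {d : ℕ} (k : ℕ) (f : Euc d → ℝ) (p : ℝ) (q : ℝ≥0∞) (t : ℝ) : ℝ≥0∞ :=
  ⨆ h ∈ {h : Euc d | ‖h‖ ≤ t}, lorentz volume (iterDiff k h f) p q (Set.Ioi 0)



/-- Half-open cube. -/
def hcube {d : ℕ} (a : Fin d → ℝ) (l : ℝ) : Set (Euc d) :=
  {x | ∀ i, a i ≤ x i ∧ x i < a i + l}

lemma cubeSet_eq_preimage {d : ℕ} (a : Fin d → ℝ) (l : ℝ) :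
    cubeSet a l = (@WithLp.ofLp 2 (Fin d → ℝ)) ⁻¹' (Set.pi univ fun i => Icc (a i) (a i + l)) := by
  ext x
  simp only [cubeSet, Set.mem_pi, Set.mem_preimage, Set.mem_univ, forall_true_left, Set.mem_Icc]
  rfl

lemma hcube_eq_preimage {d : ℕ} (a : Fin d → ℝ) (l : ℝ) :
    hcube a l = (@WithLp.ofLp 2 (Fin d → ℝ)) ⁻¹' (Set.pi univ fun i => Ico (a i) (a i + l)) := by
  ext x
  simp [hcube, Set.mem_pi]

lemma measurableSet_cubeSet {d : ℕ} (a : Fin d → ℝ) (l : ℝ) : MeasurableSet (cubeSet a l) := by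
  rw [cubeSet_eq_preimage]
  exact (PiLp.volume_preserving_ofLp (Fin d)).measurable
    (MeasurableSet.univ_pi fun i => measurableSet_Icc)

lemma measurableSet_hcube {d : ℕ} (a : Fin d → ℝ) (l : ℝ) : MeasurableSet (hcube a l) := by
  rw [hcube_eq_preimage]
  exact (PiLp.volume_preserving_ofLp (Fin d)).measurable
    (MeasurableSet.univ_pi fun i => measurableSet_Ico)

lemma volume_cubeSet {d : ℕ} (a : Fin d → ℝ) (l : ℝ) :
    volume (cubeSet a l) = ENNReal.ofReal l ^ d := by
  rw [cubeSet_eq_preimage, (PiLp.volume_preserving_ofLp (Fin d)).measure_preimage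
    (MeasurableSet.univ_pi fun i => measurableSet_Icc).nullMeasurableSet, volume_pi_pi]
  simp

lemma volume_hcube {d : ℕ} (a : Fin d → ℝ) (l : ℝ) :
    volume (hcube a l) = ENNReal.ofReal l ^ d := by
  rw [hcube_eq_preimage, (PiLp.volume_preserving_ofLp (Fin d)).measure_preimage
    (MeasurableSet.univ_pi fun i => measurableSet_Ico).nullMeasurableSet]
  rw [volume_pi_pi]
  simp

lemma hcube_subset_cubeSet {d : ℕ} (a : Fin d → ℝ) (l : ℝ) : hcube a l ⊆ cubeSet a l :=
  fun _ hx i => ⟨(hx i).1, (hx i).2.le⟩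

lemma hcube_ae_eq_cubeSet {d : ℕ} (a : Fin d → ℝ) (l : ℝ) :
    (hcube a l : Set (Euc d)) =ᵐ[volume] cubeSet a l := by
  apply ae_eq_of_subset_of_measure_ge (hcube_subset_cubeSet a l)
  · rw [volume_hcube, volume_cubeSet]
  · exact (measurableSet_hcube a l).nullMeasurableSet
  · rw [volume_cubeSet]; finiteness

/-- Dyadic index. -/
def dyIdx {d : ℕ} (a : Fin d → ℝ) (l : ℝ) (n : ℕ) (x : Euc d) : Fin d → ℤ :=
  fun i => ⌊2 ^ n * ((x i - a i) / l)⌋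

/-- Lower-left corner of a dyadic cell. -/
def dyCorner {d : ℕ} (a : Fin d → ℝ) (l : ℝ) (n : ℕ) (k : Fin d → ℤ) : Fin d → ℝ :=
  fun i => a i + k i * (l / 2 ^ n)

lemma dyIdx_eq_iff {d : ℕ} (a : Fin d → ℝ) {l : ℝ} (hl : 0 < l) (n : ℕ) (x : Euc d)
    (k : Fin d → ℤ) : dyIdx a l n x = k ↔ x ∈ hcube (dyCorner a l n k) (l / 2 ^ n) := by
  have h2 : (0:ℝ) < 2 ^ n := by positivity
  have key : ∀ i, 2 ^ n * ((x i - a i) / l) = (x i - a i) / (l / 2 ^ n) := by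
    intro i; field_simp
  have hq : 0 < l / 2 ^ n := by positivity
  simp only [dyIdx, hcube, dyCorner, funext_iff, Set.mem_ofPred_eq, key, Int.floor_eq_iff]
  refine forall_congr' fun i => ?_
  rw [le_div_iff₀ hq, div_lt_iff₀ hq]
  constructor
  · rintro ⟨h1, h2⟩; constructor <;> linarith
  · rintro ⟨h1, h2⟩; constructor <;> linarith

lemma dyIdx_succ {d : ℕ} (a : Fin d → ℝ) (l : ℝ) (n : ℕ) (x y : Euc d)
    (h : dyIdx a l (n+1) x = dyIdx a l (n+1) y) : dyIdx a l n x = dyIdx a l n y := by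
  funext i
  have hi := congrFun h i
  simp only [dyIdx] at hi ⊢
  have e : ∀ z : ℝ, ⌊2 ^ n * z⌋ = ⌊2 ^ (n+1) * z⌋ / 2 := by
    intro z
    have := Int.floor_div_natCast (2 ^ (n+1) * z : ℝ) 2
    rw [show (2:ℝ) ^ n * z = (2 ^ (n+1) * z) / (2:ℕ) by push_cast; ring]
    exact_mod_cast this
  rw [e, e, hi]

lemma dyIdx_mono {d : ℕ} (a : Fin d → ℝ) (l : ℝ) {m n : ℕ} (hmn : m ≤ n) (x y : Euc d)
    (h : dyIdx a l n x = dyIdx a l n y) : dyIdx a l m x = dyIdx a l m y := by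
  induction n, hmn using Nat.le_induction with
  | base => exact h
  | succ n hmn ih => exact ih (dyIdx_succ a l n x y h)

lemma density_dyadic {d : ℕ} (a : Fin d → ℝ) {l : ℝ} (hl : 0 < l) (E : Set (Euc d))
    (hE : MeasurableSet E) : ∀ᵐ x ∂(volume : Measure (Euc d)), x ∈ E → ∃ n,
      volume (hcube (dyCorner a l n (dyIdx a l n x)) (l / 2 ^ n)) ≤
        2 * volume (E ∩ hcube (dyCorner a l n (dyIdx a l n x)) (l / 2 ^ n)) := by
  have mp := PiLp.volume_preserving_toLp (Fin d)
  have mpo := PiLp.volume_preserving_ofLp (Fin d)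
  set E' : Set (Fin d → ℝ) := (@WithLp.toLp 2 (Fin d → ℝ)) ⁻¹' E with hE'
  have hE'm : MeasurableSet E' := mp.measurable hE
  have h := IsUnifLocDoublingMeasure.ae_tendsto_measure_inter_div (volume : Measure (Fin d → ℝ)) E' 1
  rw [ae_restrict_iff' hE'm] at h
  have h2 := mpo.quasiMeasurePreserving.ae h
  filter_upwards [h2] with x hx hxE
  have hδ : ∀ n : ℕ, 0 < l / 2 ^ (n+1) := fun n => by positivity
  have ball_eq : ∀ n : ℕ, (@WithLp.ofLp 2 (Fin d → ℝ)) ⁻¹' (Metric.closedBall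
      (fun i => dyCorner a l n (dyIdx a l n x) i + l / 2 ^ (n+1)) (l / 2 ^ (n+1))) =
      cubeSet (dyCorner a l n (dyIdx a l n x)) (l / 2 ^ n) := by
    intro n
    rw [cubeSet_eq_preimage, closedBall_pi _ (hδ n).le]
    congr 1
    congr 1
    funext i
    rw [Real.closedBall_eq_Icc]
    congr 1 <;> rw [pow_succ] <;> field_simp <;> ring
  have T := hx hxE (ι := ℕ) (l := atTop)
    (fun n => fun i => dyCorner a l n (dyIdx a l n x) i + l / 2 ^ (n+1)) (fun n => l / 2 ^ (n+1))
    (by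
      rw [tendsto_nhdsWithin_iff]
      refine ⟨?_, Eventually.of_forall fun n => hδ n⟩
      have := (tendsto_pow_atTop_nhds_zero_of_lt_one (r := (1/2:ℝ)) (by norm_num) (by norm_num)).const_mul l
      rw [mul_zero] at this
      refine (this.comp (tendsto_add_atTop_nat 1)).congr fun n => ?_
      simp [div_eq_mul_inv])
    (by
      refine Eventually.of_forall fun n => ?_
      rw [one_mul, ← Set.mem_preimage, ball_eq]
      exact hcube_subset_cubeSet _ _ ((dyIdx_eq_iff a hl n x _).1 rfl))
  have ev := T.eventually (lt_mem_nhds (show (1/2 : ℝ≥0∞) < 1 by simp))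
  obtain ⟨n, hn⟩ := ev.exists
  refine ⟨n, ?_⟩
  have e1 : volume (Metric.closedBall
      (fun i => dyCorner a l n (dyIdx a l n x) i + l / 2 ^ (n+1)) (l / 2 ^ (n+1))) =
      volume (hcube (dyCorner a l n (dyIdx a l n x)) (l / 2 ^ n)) := by
    rw [← mpo.measure_preimage measurableSet_closedBall.nullMeasurableSet, ball_eq]
    exact measure_congr (hcube_ae_eq_cubeSet _ _).symm
  have e2 : volume (E' ∩ Metric.closedBall
      (fun i => dyCorner a l n (dyIdx a l n x) i + l / 2 ^ (n+1)) (l / 2 ^ (n+1))) =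
      volume (E ∩ hcube (dyCorner a l n (dyIdx a l n x)) (l / 2 ^ n)) := by
    rw [← mpo.measure_preimage (hE'm.inter measurableSet_closedBall).nullMeasurableSet, preimage_inter,
      ball_eq]
    exact measure_congr ((EventuallyEq.refl _ _).inter (hcube_ae_eq_cubeSet _ _).symm)
  rw [e1, e2] at hn
  have hfin : volume (hcube (dyCorner a l n (dyIdx a l n x)) (l / 2 ^ n)) ≠ ∞ := by
    rw [volume_hcube]; finiteness
  have := (ENNReal.lt_div_iff_mul_lt (Or.inr (by simp)) (Or.inl hfin)).1 hn
  have h3 := mul_le_mul_right this.le (2:ℝ≥0∞)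
  calc _ = 2 * (1/2 * volume (hcube (dyCorner a l n (dyIdx a l n x)) (l / 2 ^ n))) := by
        rw [← mul_assoc, one_div, ENNReal.mul_inv_cancel (by simp) (by simp), one_mul]
    _ ≤ _ := by gcongr


lemma cheb_avg {d : ℕ} {Q : Set (Euc d)} (hQ : MeasurableSet Q) (hfin : volume Q ≠ ∞)
    {f : Euc d → ℝ} (hf : IntegrableOn f Q volume) (c : ℝ) {γ s : ℝ} (hγ : 0 < γ) (hs : 0 < s)
    (h : ⨍ y in Q, |f y - c| ≤ γ) :
    ENNReal.ofReal s * volume (Q ∩ {x | s * γ ≤ |f x - c|}) ≤ volume Q := by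
  by_cases h0 : volume Q = 0
  · have : volume (Q ∩ {x | s * γ ≤ |f x - c|}) = 0 := measure_mono_null inter_subset_left h0
    rw [this]; simp
  have : Fact (volume Q < ∞) := ⟨hfin.lt_top⟩
  have hint : Integrable (fun y => |f y - c|) (volume.restrict Q) :=
    (Integrable.sub hf (integrable_const c)).abs
  have hm := mul_meas_ge_le_integral_of_nonneg (μ := volume.restrict Q)
    (Eventually.of_forall fun y => abs_nonneg (f y - c)) hint (s * γ)
  rw [measureReal_restrict_apply' hQ, inter_comm] at hm
  rw [setAverage_eq, smul_eq_mul] at h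
  have hV : 0 < volume.real Q := ENNReal.toReal_pos h0 hfin
  rw [inv_mul_le_iff₀ hV] at h
  have h2 : s * volume.real (Q ∩ {x | s * γ ≤ |f x - c|}) ≤ volume.real Q := by
    refine le_of_mul_le_mul_right ?_ hγ
    calc _ = s * γ * volume.real (Q ∩ {x | s * γ ≤ |f x - c|}) := by ring
      _ ≤ _ := hm.trans h
  have hfin2 : volume (Q ∩ {x | s * γ ≤ |f x - c|}) ≠ ∞ :=
    measure_ne_top_of_subset inter_subset_left hfin
  rw [← ENNReal.ofReal_toReal hfin, ← ENNReal.ofReal_toReal hfin2, ← ENNReal.ofReal_mul hs.le]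
  exact ENNReal.ofReal_le_ofReal h2

lemma avg_le_of_sharp {d : ℕ} {Q0 Q : Set (Euc d)} {f : Euc d → ℝ} {x : Euc d} (hQ : IsCube Q)
    (hx : x ∈ Q) (hsub : Q ⊆ Q0) {γ : ℝ} (hγ : 0 < γ)
    (h : sharpLocal volume Q0 f x ≤ ENNReal.ofReal γ) :
    ⨍ y in Q, |f y - ⨍ z in Q, f z| ≤ γ := by
  have h1 : ENNReal.ofReal (⨍ y in Q, |f y - ⨍ z in Q, f z|) ≤ sharpLocal volume Q0 f x := by
    unfold sharpLocal
    exact le_iSup₂_of_le Q ⟨hQ, hx, hsub⟩ le_rfl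
  exact (ENNReal.ofReal_le_ofReal_iff hγ.le).1 (h1.trans h)

/-- Core good-lambda type inequality. -/
lemma core {d : ℕ} (a : Fin d → ℝ) {l : ℝ} (hl : 0 < l) {f : Euc d → ℝ} (hfm : Measurable f)
    (hf : IntegrableOn f (cubeSet a l) volume) (m L γ : ℝ) (hγ : 0 < γ) (u : ℝ≥0∞)
    (hE : volume (cubeSet a l ∩ {x | L < |f x - m|}) ≤ 2 * u)
    (hG : 2 * volume (cubeSet a l ∩ {x | ENNReal.ofReal γ < sharpLocal volume (cubeSet a l) f x}) ≤ u)
    (hu : (4 * 2 ^ d) * (2 * u) < volume (cubeSet a l)) :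
    volume (cubeSet a l ∩ {x | L + (2 + 4 * (4 * 2 ^ d)) * γ < |f x - m|}) ≤ u := by
  set Q0 := cubeSet a l with hQ0
  set A : ℝ≥0∞ := 4 * 2 ^ d with hA
  set G := Q0 ∩ {x | ENNReal.ofReal γ < sharpLocal volume Q0 f x} with hGdef
  set E := hcube a l ∩ {x | L < |f x - m|} with hEdef
  have hEm : MeasurableSet E := (measurableSet_hcube a l).inter
    (measurableSet_lt measurable_const (by fun_prop))
  have hEu : volume E ≤ 2 * u := (measure_mono (inter_subset_inter_left _
    (hcube_subset_cubeSet a l))).trans hE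
  set H := hcube a l ∩ {x | L + (2 + 4 * (4 * 2 ^ d)) * γ < |f x - m|} with hHdef
  have hHE : H ⊆ E := by
    rintro x ⟨h1, h2⟩
    refine ⟨h1, ?_⟩
    rw [Set.mem_ofPred_eq] at h2 ⊢
    have : 0 ≤ (2 + 4 * (4 * 2 ^ d)) * γ := by positivity
    linarith
  have hHeq : volume (Q0 ∩ {x | L + (2 + 4 * (4 * 2 ^ d)) * γ < |f x - m|}) = volume H :=
    measure_congr ((hcube_ae_eq_cubeSet a l).symm.inter (EventuallyEq.refl _ _))
  rw [hHeq]
  -- cells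
  let cell : ℕ → (Fin d → ℤ) → Set (Euc d) := fun n k => hcube (dyCorner a l n k) (l / 2 ^ n)
  have cell_iff : ∀ n k x, x ∈ cell n k ↔ dyIdx a l n x = k := fun n k x =>
    (dyIdx_eq_iff a hl n x k).symm
  have cell0 : cell 0 0 = hcube a l := by
    have : dyCorner a l 0 0 = a := by funext i; simp [dyCorner]
    simp only [cell, this, pow_zero, div_one]
  have mem0 : ∀ x, x ∈ hcube a l ↔ dyIdx a l 0 x = 0 := fun x => by rw [← cell0, cell_iff]
  let P : ℕ → (Fin d → ℤ) → Prop := fun n k => volume (cell n k) ≤ A * volume (E ∩ cell n k)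
  let S : ℕ × (Fin d → ℤ) → Set (Euc d) := fun nk => {x | dyIdx a l nk.1 x = nk.2 ∧
    P nk.1 (dyIdx a l nk.1 x) ∧ ∀ j < nk.1, ¬ P j (dyIdx a l j x)}
  have S_sub : ∀ nk, S nk ⊆ cell nk.1 nk.2 := fun nk x hx => (cell_iff _ _ _).2 hx.1
  have S_eq : ∀ nk x, x ∈ S nk → S nk = cell nk.1 nk.2 := by
    intro nk x hx
    refine Subset.antisymm (S_sub nk) fun y hy => ?_
    have hy' := (cell_iff _ _ _).1 hy
    refine ⟨hy', ?_, ?_⟩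
    · rw [hy', ← hx.1]; exact hx.2.1
    · intro j hj
      rw [dyIdx_mono a l hj.le y x (hy'.trans hx.1.symm)]
      exact hx.2.2 j hj
  have S_meas : ∀ nk, MeasurableSet (S nk) := by
    intro nk
    rcases (S nk).eq_empty_or_nonempty with h | ⟨x, hx⟩
    · rw [h]; exact MeasurableSet.empty
    · rw [S_eq nk x hx]; exact measurableSet_hcube _ _
  have S_disj : Pairwise (Function.onFun Disjoint S) := by
    intro p q hpq
    rw [Function.onFun, Set.disjoint_left]
    intro x hp hq
    apply hpq
    have h1 : p.1 = q.1 := by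
      rcases lt_trichotomy p.1 q.1 with h | h | h
      · exact absurd hp.2.1 (hq.2.2 _ h)
      · exact h
      · exact absurd hq.2.1 (hp.2.2 _ h)
    refine Prod.ext h1 ?_
    rw [← hp.1, ← hq.1, h1]
  have cover : ∀ᵐ x ∂(volume : Measure (Euc d)), x ∈ E → x ∈ ⋃ nk, S nk := by
    filter_upwards [density_dyadic a hl E hEm] with x hx hxE
    have hex : ∃ n, P n (dyIdx a l n x) := by
      obtain ⟨n, hn⟩ := hx hxE
      refine ⟨n, hn.trans ?_⟩
      gcongr
      rw [hA]
      calc (2:ℝ≥0∞) ≤ 4 * 1 := by norm_num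
        _ ≤ 4 * 2 ^ d := by gcongr; exact one_le_pow₀ (by norm_num)
    classical
    rw [mem_iUnion]
    exact ⟨(Nat.find hex, dyIdx a l (Nat.find hex) x), rfl, Nat.find_spec hex,
      fun j hj => Nat.find_min hex hj⟩
  have notP0 : ¬ P 0 0 := by
    intro h
    simp only [P, cell0] at h
    have : volume (hcube a l) ≤ A * (2 * u) := h.trans (by
      gcongr; exact (measure_mono inter_subset_left).trans hEu)
    rw [measure_congr (hcube_ae_eq_cubeSet a l)] at this
    exact absurd hu (not_lt.2 this)
  have local_est : ∀ nk, 4 * volume (H ∩ S nk) ≤ 4 * volume (G ∩ S nk) + volume (E ∩ S nk) := by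
    rintro ⟨n, k⟩
    rcases (H ∩ S (n,k)).eq_empty_or_nonempty with h | ⟨x, hxH, hxS⟩
    · rw [h]; simp
    rw [S_eq _ _ hxS]
    have hx0 : dyIdx a l 0 x = 0 := (mem0 x).1 hxH.1
    have hxn : dyIdx a l n x = k := hxS.1
    have hPn : P n k := hxn ▸ hxS.2.1
    have hQsub : cell n k ⊆ hcube a l := by
      intro y hy
      rw [mem0, ← hx0]
      exact dyIdx_mono a l (Nat.zero_le n) y x (((cell_iff _ _ _).1 hy).trans hxn.symm)
    obtain ⟨j, rfl⟩ : ∃ j, n = j + 1 := by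
      rcases n with _ | j
      · exfalso
        rw [hx0] at hxn
        rw [← hxn] at hPn
        exact notP0 hPn
      · exact ⟨j, rfl⟩
    have hnP : ¬ P j (dyIdx a l j x) := hxS.2.2 j (Nat.lt_succ_self j)
    -- the closed cube
    set Q := cubeSet (dyCorner a l (j+1) k) (l / 2 ^ (j+1)) with hQ
    have hcQ : cell (j+1) k ⊆ Q := hcube_subset_cubeSet _ _
    have hlj : 0 < l / 2 ^ (j+1) := by positivity
    have hQQ0 : Q ⊆ Q0 := by
      have hk : ∀ i, 0 ≤ k i ∧ k i + 1 ≤ 2 ^ (j+1) := by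
        have hc : (WithLp.toLp 2 (dyCorner a l (j+1) k) : Euc d) ∈ cell (j+1) k := by
          intro i; simp; positivity
        intro i
        have h1 := hQsub hc i
        simp only [dyCorner] at h1
        obtain ⟨h1, h2⟩ := h1
        constructor
        · have : 0 ≤ (k i : ℝ) * (l / 2 ^ (j+1)) := by linarith
          have := nonneg_of_mul_nonneg_left this hlj
          exact_mod_cast this
        · have : (k i : ℝ) * (l / 2 ^ (j+1)) < 2 ^ (j+1) * (l / 2 ^ (j+1)) := by
            rw [mul_div_cancel₀ l (by positivity)]; linarith
          have := lt_of_mul_lt_mul_right this hlj.le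
          have : k i < 2 ^ (j+1) := by exact_mod_cast this
          exact this
      intro y hy i
      have h1 := hy i
      simp only [dyCorner] at h1
      obtain ⟨h1, h2⟩ := h1
      obtain ⟨k1, k2⟩ := hk i
      have k1' : (0:ℝ) ≤ k i := by exact_mod_cast k1
      have k2' : (k i : ℝ) + 1 ≤ 2 ^ (j+1) := by exact_mod_cast k2
      constructor
      · have : 0 ≤ (k i : ℝ) * (l / 2 ^ (j+1)) := by positivity
        linarith
      · have : ((k i : ℝ) + 1) * (l / 2 ^ (j+1)) ≤ 2 ^ (j+1) * (l / 2 ^ (j+1)) := by gcongr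
        rw [mul_div_cancel₀ l (by positivity)] at this
        linarith
    have hvQ : volume Q = volume (cell (j+1) k) := by
      simp only [cell, hQ, volume_hcube, volume_cubeSet]
    have hQfin : volume Q ≠ ∞ := by rw [hQ, volume_cubeSet]; finiteness
    have hQpos : volume Q ≠ 0 := by
      rw [hQ, volume_cubeSet]
      exact pow_ne_zero _ (by simpa using hlj)
    by_cases hcase : ∃ y ∈ Q, sharpLocal volume Q0 f y ≤ ENNReal.ofReal γ
    swap
    · push Not at hcase
      have : cell (j+1) k ⊆ G := fun y hy => ⟨hQQ0 (hcQ hy), hcase y (hcQ hy)⟩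
      refine le_trans ?_ le_self_add
      exact mul_le_mul_right (measure_mono
        (subset_inter (inter_subset_right.trans this) inter_subset_right)) 4
    · obtain ⟨y, hyQ, hy⟩ := hcase
      have havg := avg_le_of_sharp ⟨_, _, hlj, hQ⟩ hyQ hQQ0 hγ hy
      set c := ⨍ z in Q, f z with hc
      have hfQ : IntegrableOn f Q volume := hf.mono_set hQQ0
      have ch2 := cheb_avg (measurableSet_cubeSet _ _) hQfin hfQ c hγ (s := 2) (by norm_num) havg
      have chK := cheb_avg (measurableSet_cubeSet _ _) hQfin hfQ c hγ (s := 4 * (4 * 2 ^ d))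
        (by positivity) havg
      -- parent estimate
      have hEcell : 4 * volume (E ∩ cell (j+1) k) < volume (cell (j+1) k) := by
        simp only [P, not_le] at hnP
        have e1 : volume (cell j (dyIdx a l j x)) = 2 ^ d * volume (cell (j+1) k) := by
          simp only [cell, volume_hcube]
          rw [← mul_pow]
          congr 1
          rw [show (2:ℝ≥0∞) = ENNReal.ofReal 2 by simp, ← ENNReal.ofReal_mul (by norm_num)]
          congr 1
          rw [pow_succ]; field_simp
        have hsub : cell (j+1) k ⊆ cell j (dyIdx a l j x) := by
          intro z hz
          rw [cell_iff] at hz ⊢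
          exact dyIdx_mono a l (Nat.le_succ j) z x (hz.trans hxn.symm)
        rw [e1, hA] at hnP
        have h3 : 2 ^ d * (4 * volume (E ∩ cell (j+1) k)) < 2 ^ d * volume (cell (j+1) k) := by
          refine lt_of_le_of_lt ?_ hnP
          calc _ = 4 * 2 ^ d * volume (E ∩ cell (j+1) k) := by ring
            _ ≤ _ := by gcongr
        exact lt_of_mul_lt_mul_left' h3
      -- good point
      obtain ⟨z, hzc, hz1, hz2⟩ : ∃ z ∈ cell (j+1) k, |f z - m| ≤ L ∧ |f z - c| < 2 * γ := by
        by_contra hcon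
        push Not at hcon
        have hsub : cell (j+1) k ⊆ (E ∩ cell (j+1) k) ∪ (Q ∩ {x | 2 * γ ≤ |f x - c|}) := by
          intro z hz
          by_cases hzL : |f z - m| ≤ L
          · exact Or.inr ⟨hcQ hz, hcon z hz hzL⟩
          · exact Or.inl ⟨⟨hQsub hz, not_le.1 hzL⟩, hz⟩
        have h1 := (measure_mono hsub).trans (measure_union_le (μ := volume) _ _)
        rw [← hvQ] at h1 hEcell
        have h2 : 4 * volume Q ≤ 4 * volume (E ∩ cell (j+1) k) + 2 * volume Q := by
          calc 4 * volume Q ≤ 4 * (volume (E ∩ cell (j+1) k) + volume (Q ∩ {x | 2 * γ ≤ |f x - c|})) := by gcongr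
            _ = 4 * volume (E ∩ cell (j+1) k) + 2 * (ENNReal.ofReal 2 * volume (Q ∩ {x | 2 * γ ≤ |f x - c|})) := by
              rw [show ENNReal.ofReal 2 = 2 by simp]; ring
            _ ≤ _ := by gcongr
        have h3 : 4 * volume Q < 4 * volume Q := by
          calc 4 * volume Q ≤ _ := h2
            _ < volume Q + 2 * volume Q := ENNReal.add_lt_add_right (by finiteness) hEcell
            _ ≤ 4 * volume Q := by rw [← one_add_mul]; gcongr; norm_num
        exact lt_irrefl _ h3
      have hcm : |c - m| ≤ L + 2 * γ := by
        have := abs_sub_le c (f z) m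
        rw [abs_sub_comm c (f z)] at this
        linarith
      have hHsub : H ∩ cell (j+1) k ⊆ Q ∩ {x | 4 * (4 * 2 ^ d) * γ ≤ |f x - c|} := by
        rintro w ⟨hw1, hw2⟩
        refine ⟨hcQ hw2, ?_⟩
        have h1 : L + (2 + 4 * (4 * 2 ^ d)) * γ < |f w - m| := hw1.2
        have := abs_sub_le (f w) c m
        show 4 * (4 * 2 ^ d) * γ ≤ |f w - c|
        nlinarith
      refine le_trans ?_ le_add_self
      have hAe : ENNReal.ofReal (4 * (4 * 2 ^ d)) = A * 4 := by
        rw [hA, ENNReal.ofReal_mul (by norm_num), ENNReal.ofReal_mul (by norm_num),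
          ENNReal.ofReal_pow (by norm_num)]
        simp [mul_comm]
      rw [hAe, hvQ] at chK
      have h5 : A * (4 * volume (H ∩ cell (j+1) k)) ≤ A * volume (E ∩ cell (j+1) k) := by
        calc _ = A * 4 * volume (H ∩ cell (j+1) k) := by ring
          _ ≤ A * 4 * volume (Q ∩ {x | 4 * (4 * 2 ^ d) * γ ≤ |f x - c|}) := by gcongr
          _ ≤ _ := chK
          _ ≤ _ := hPn
      refine (ENNReal.mul_le_mul_iff_right ?_ ?_).1 h5
      · rw [hA]; simp
      · rw [hA]; finiteness
  have sum_le : ∀ B : Set (Euc d), ∑' nk, volume (B ∩ S nk) ≤ volume B := by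
    intro B
    have : ∀ nk, volume (B ∩ S nk) = (volume.restrict B) (S nk) := fun nk => by
      rw [Measure.restrict_apply (S_meas nk), inter_comm]
    simp_rw [this]
    rw [← measure_iUnion S_disj S_meas]
    exact (measure_mono (subset_univ _)).trans (by simp)
  have hH : volume H ≤ ∑' nk, volume (H ∩ S nk) := by
    have : volume H ≤ volume (⋃ nk, H ∩ S nk) := by
      apply measure_mono_ae
      filter_upwards [cover] with x hx hxH
      have := hx (hHE hxH)
      rw [mem_iUnion] at this
      obtain ⟨nk, h⟩ := this
      exact mem_iUnion.2 ⟨nk, hxH, h⟩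
    exact this.trans (measure_iUnion_le _)
  have final : 4 * volume H ≤ 4 * u := by
    calc 4 * volume H ≤ 4 * ∑' nk, volume (H ∩ S nk) := by gcongr
      _ = ∑' nk, 4 * volume (H ∩ S nk) := ENNReal.tsum_mul_left.symm
      _ ≤ ∑' nk, (4 * volume (G ∩ S nk) + volume (E ∩ S nk)) := ENNReal.tsum_le_tsum local_est
      _ = 4 * ∑' nk, volume (G ∩ S nk) + ∑' nk, volume (E ∩ S nk) := by
        rw [ENNReal.tsum_add, ENNReal.tsum_mul_left]
      _ ≤ 4 * volume G + volume E := by gcongr <;> exact sum_le _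
      _ = 2 * (2 * volume G) + volume E := by ring
      _ ≤ 2 * u + 2 * u := by gcongr
      _ = 4 * u := by ring
  exact (ENNReal.mul_le_mul_iff_right (by norm_num) (by norm_num)).1 final


lemma rearr_antitone {α : Type*} [MeasurableSpace α] (μ : Measure α) (g : α → ℝ≥0∞) :
    Antitone (rearr μ g) := by
  intro s t hst
  exact sInf_le_sInf fun l hl => le_trans hl (ENNReal.ofReal_le_ofReal hst)

lemma rearr_le {α : Type*} [MeasurableSpace α] {μ : Measure α} {g : α → ℝ≥0∞} {t : ℝ} {l : ℝ≥0∞}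
    (h : μ {x | l < g x} ≤ ENNReal.ofReal t) : rearr μ g t ≤ l := sInf_le h

lemma meas_le_of_rearr_lt {α : Type*} [MeasurableSpace α] {μ : Measure α} {g : α → ℝ≥0∞} {t : ℝ}
    {l : ℝ≥0∞} (h : rearr μ g t < l) : μ {x | l < g x} ≤ ENNReal.ofReal t := by
  obtain ⟨l', hl', hlt⟩ := sInf_lt_iff.1 h
  exact (measure_mono fun x hx => hlt.trans hx).trans hl'

lemma le_of_forall_real {X Y Z : ℝ≥0∞} {K : ℝ} (hK : 0 < K)
    (h : ∀ L γ : ℝ, 0 < L → 0 < γ → Y < ENNReal.ofReal L → Z < ENNReal.ofReal γ →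
      X ≤ ENNReal.ofReal (L + K * γ)) : X ≤ Y + ENNReal.ofReal K * Z := by
  by_cases hY : Y = ∞
  · simp [hY]
  by_cases hZ : Z = ∞
  · have : ENNReal.ofReal K ≠ 0 := by simpa using hK
    simp [hZ, this]
  refine ENNReal.le_of_forall_pos_le_add fun ε hε _ => ?_
  have hε' : (0:ℝ) < ε := hε
  have hy := ENNReal.toReal_nonneg (a := Y)
  have hz := ENNReal.toReal_nonneg (a := Z)
  have h1 : 0 < ε / 2 / K := by positivity
  have := h (Y.toReal + ε / 2) (Z.toReal + ε / 2 / K) (by positivity) (by positivity)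
    ((ENNReal.lt_ofReal_iff_toReal_lt hY).2 (by linarith))
    ((ENNReal.lt_ofReal_iff_toReal_lt hZ).2 (by linarith))
  refine this.trans ?_
  have e : Y.toReal + ε / 2 + K * (Z.toReal + ε / 2 / K) = Y.toReal + K * Z.toReal + ε := by
    field_simp; ring
  rw [e, ENNReal.ofReal_add (by positivity) hε'.le, ENNReal.ofReal_add hy (by positivity),
    ENNReal.ofReal_mul hK.le, ENNReal.ofReal_toReal hY, ENNReal.ofReal_toReal hZ,
    ENNReal.ofReal_coe_nnreal]

lemma rearrR_zero_of_ge {d : ℕ} {Q0 : Set (Euc d)} (h : Euc d → ℝ) {u : ℝ}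
    (hu : volume Q0 ≤ ENNReal.ofReal u) : rearrR (volume.restrict Q0) h u = 0 := by
  rw [← nonpos_iff_eq_zero]
  refine rearr_le ((measure_mono (subset_univ _)).trans ?_)
  simpa using hu

/-- Key rearrangement inequality. -/
lemma key_rearr {d : ℕ} (a : Fin d → ℝ) {l : ℝ} (hl : 0 < l) {f : Euc d → ℝ} (hfm : Measurable f)
    (hf : IntegrableOn f (cubeSet a l) volume) {u : ℝ} (hu : 0 < u) :
    rearrR (volume.restrict (cubeSet a l)) (fun x => f x - ⨍ z in cubeSet a l, f z) u ≤
      rearrR (volume.restrict (cubeSet a l)) (fun x => f x - ⨍ z in cubeSet a l, f z) (2 * u) +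
      ENNReal.ofReal (2 + 4 * (4 * 2 ^ d)) *
      rearr (volume.restrict (cubeSet a l)) (sharpLocal volume (cubeSet a l) f) (u / 2) := by
  have hQm := measurableSet_cubeSet a l
  set m := ⨍ z in cubeSet a l, f z with hm
  set Q0 := cubeSet a l with hQ0
  have hQfin : volume Q0 ≠ ∞ := by rw [hQ0, volume_cubeSet]; finiteness
  apply le_of_forall_real (by positivity)
  intro L γ hL hγ hFL hgγ
  have hF := meas_le_of_rearr_lt hFL
  have hg := meas_le_of_rearr_lt hgγ
  rw [Measure.restrict_apply' hQm, inter_comm] at hF hg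
  have eset : ∀ L : ℝ, 0 < L → {x : Euc d | ENNReal.ofReal L < ENNReal.ofReal |f x - m|} =
      {x | L < |f x - m|} := by
    intro L hL
    ext x
    simp only [Set.mem_ofPred_eq]
    exact ENNReal.ofReal_lt_ofReal_iff_of_nonneg hL.le
  rw [eset L hL] at hF
  have e2 : ENNReal.ofReal (2 * u) = 2 * ENNReal.ofReal u := by
    rw [ENNReal.ofReal_mul (by norm_num)]; simp
  have e3 : 2 * ENNReal.ofReal (u / 2) = ENNReal.ofReal u := by
    rw [show (2:ℝ≥0∞) = ENNReal.ofReal 2 by simp, ← ENNReal.ofReal_mul (by norm_num)]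
    congr 1; ring
  have hLK : 0 < L + (2 + 4 * (4 * 2 ^ d)) * γ := by positivity
  rcases le_or_gt (volume Q0) (ENNReal.ofReal u) with h1 | h1
  · rw [rearrR_zero_of_ge _ h1]; exact zero_le
  refine rearr_le ?_
  rw [Measure.restrict_apply' hQm, inter_comm, eset _ hLK]
  rcases lt_or_ge ((4 * 2 ^ d) * (2 * ENNReal.ofReal u)) (volume Q0) with h2 | h2
  · refine core a hl hfm hf m L γ hγ (ENNReal.ofReal u) ?_ ?_ h2
    · rw [← e2]; exact hF
    · rw [← e3]; gcongr
  · -- the average is at most γ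
    obtain ⟨y, hyQ, hy⟩ : ∃ y ∈ Q0, sharpLocal volume Q0 f y ≤ ENNReal.ofReal γ := by
      by_contra hcon
      push Not at hcon
      have : Q0 ∩ {x | ENNReal.ofReal γ < sharpLocal volume Q0 f x} = Q0 :=
        inter_eq_left.2 fun x hx => hcon x hx
      rw [this] at hg
      have : ENNReal.ofReal (u / 2) ≤ ENNReal.ofReal u := ENNReal.ofReal_le_ofReal (by linarith)
      exact absurd (hg.trans this) (not_le.2 h1)
    have havg := avg_le_of_sharp ⟨a, l, hl, hQ0⟩ hyQ subset_rfl hγ hy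
    have ch := cheb_avg hQm hQfin hf m hγ (s := 2 + 4 * (4 * 2 ^ d)) (by positivity) havg
    have hsub : Q0 ∩ {x | L + (2 + 4 * (4 * 2 ^ d)) * γ < |f x - m|} ⊆
        Q0 ∩ {x | (2 + 4 * (4 * 2 ^ d)) * γ ≤ |f x - m|} := by
      rintro x ⟨hx1, hx2⟩
      refine ⟨hx1, ?_⟩
      rw [Set.mem_ofPred_eq] at hx2 ⊢
      linarith
    refine (measure_mono hsub).trans ?_
    have hc : (4 * 2 ^ d) * 2 ≤ ENNReal.ofReal (2 + 4 * (4 * 2 ^ d)) := by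
      have : (4 * 2 ^ d * 2 : ℝ≥0∞) = ENNReal.ofReal (4 * 2 ^ d * 2) := by
        rw [ENNReal.ofReal_mul (by positivity), ENNReal.ofReal_mul (by norm_num),
          ENNReal.ofReal_pow (by norm_num)]
        simp
      rw [this]
      apply ENNReal.ofReal_le_ofReal
      have : (0:ℝ) < 2 ^ d := by positivity
      linarith
    have h3 : ((4 * 2 ^ d) * 2) * volume (Q0 ∩ {x | (2 + 4 * (4 * 2 ^ d)) * γ ≤ |f x - m|}) ≤
        ((4 * 2 ^ d) * 2) * ENNReal.ofReal u := by
      calc _ ≤ ENNReal.ofReal (2 + 4 * (4 * 2 ^ d)) * volume (Q0 ∩ {x | (2 + 4 * (4 * 2 ^ d)) * γ ≤ |f x - m|}) := by gcongr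
        _ ≤ volume Q0 := ch
        _ ≤ _ := h2
        _ = _ := by ring
    exact (ENNReal.mul_le_mul_iff_right (by simp) (by finiteness)).1 h3

lemma rearrR_sub_le {α : Type*} [MeasurableSpace α] (μ : Measure α) (f : α → ℝ) (m u : ℝ) :
    rearrR μ (fun x => f x - m) u ≤ rearrR μ f u + ENNReal.ofReal |m| := by
  unfold rearrR
  rw [rearr, rearr, ENNReal.sInf_add]
  refine le_iInf₂ fun l hl => sInf_le ?_
  refine le_trans (measure_mono fun x hx => ?_) hl
  rw [Set.mem_ofPred_eq] at hx ⊢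
  have h1 : ENNReal.ofReal |f x - m| ≤ ENNReal.ofReal |f x| + ENNReal.ofReal |m| := by
    rw [← ENNReal.ofReal_add (abs_nonneg _) (abs_nonneg _)]
    exact ENNReal.ofReal_le_ofReal (abs_sub _ _)
  have h2 := hx.trans_le h1
  exact lt_of_add_lt_add_right h2


lemma lintegral_scale (φ : ℝ → ℝ≥0∞) {c : ℝ} (hc : 0 < c) (T : ℝ) :
    ∫⁻ u in Ioo 0 T, φ (c * u) / ENNReal.ofReal u = ∫⁻ u in Ioo 0 (c * T), φ u / ENNReal.ofReal u := by
  have hemb : MeasurableEmbedding (fun x : ℝ => c * x) :=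
    (MeasurableEquiv.mulLeft₀ c hc.ne').measurableEmbedding
  have h1 := hemb.lintegral_map (μ := volume) ((Ioo 0 (c * T)).indicator fun u => φ u / ENNReal.ofReal u)
  rw [Real.map_volume_mul_left hc.ne', lintegral_smul_measure,
    lintegral_indicator measurableSet_Ioo] at h1
  have hcc : ENNReal.ofReal c * ENNReal.ofReal |c⁻¹| = 1 := by
    rw [← ENNReal.ofReal_mul hc.le, abs_of_pos (by positivity), mul_inv_cancel₀ hc.ne']; simp
  have h2 := congrArg (fun z => ENNReal.ofReal c * z) h1
  simp only [smul_eq_mul, ← mul_assoc, hcc, one_mul] at h2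
  rw [h2, ← lintegral_const_mul' _ _ (by simp), ← lintegral_indicator measurableSet_Ioo]
  congr 1
  funext u
  by_cases hu : u ∈ Ioo 0 T
  · have hu' : c * u ∈ Ioo 0 (c * T) := ⟨by have := hu.1; positivity, by have := hu.2; gcongr⟩
    rw [indicator_of_mem hu, indicator_of_mem hu', ENNReal.ofReal_mul hc.le, div_eq_mul_inv,
      div_eq_mul_inv, ENNReal.mul_inv (Or.inr (by simp)) (Or.inl (by simp)),
      mul_left_comm, ← mul_assoc (ENNReal.ofReal c), ENNReal.mul_inv_cancel (by simpa using hc) (by simp), one_mul]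
  · have hu' : c * u ∉ Ioo 0 (c * T) := by
      rintro ⟨h1, h2⟩
      exact hu ⟨pos_of_mul_pos_right h1 hc.le, lt_of_mul_lt_mul_left h2 hc.le⟩
    rw [indicator_of_notMem hu, indicator_of_notMem hu', mul_zero]

lemma absorb {X Y : ℝ≥0∞} {θ : ℝ} (h0 : 0 ≤ θ) (h1 : θ < 1) (hX : X ≠ ∞)
    (h : X ≤ ENNReal.ofReal θ * X + Y) : X ≤ ENNReal.ofReal (1 - θ)⁻¹ * Y := by
  by_cases hY : Y = ∞
  · rw [hY, ENNReal.mul_top]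
    · exact le_top
    · have : 0 < 1 - θ := by linarith
      simpa using this
  lift X to NNReal using hX
  lift Y to NNReal using hY
  have e : ∀ Z : NNReal, (Z : ℝ≥0∞) = ENNReal.ofReal Z := fun Z => (ENNReal.ofReal_coe_nnreal).symm
  have hp : 0 < 1 - θ := by linarith
  rw [e X, e Y, ← ENNReal.ofReal_mul h0, ← ENNReal.ofReal_add (by positivity) (by positivity),
    ENNReal.ofReal_le_ofReal_iff (by positivity)] at h
  rw [e X, e Y, ← ENNReal.ofReal_mul (by positivity)]
  apply ENNReal.ofReal_le_ofReal
  rw [inv_mul_eq_div, le_div_iff₀ hp]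
  linarith

lemma add_rpow_split (a b : ℝ≥0∞) {δ ρ : ℝ} (hδ : 0 < δ) (hρ : 0 < ρ) :
    (a + b) ^ ρ ≤ (ENNReal.ofReal (1 + δ) * a) ^ ρ + (ENNReal.ofReal (1 + δ⁻¹) * b) ^ ρ := by
  have hδi : 0 < δ⁻¹ := by positivity
  rcases le_total b (ENNReal.ofReal δ * a) with h | h
  · refine le_trans ?_ le_self_add
    gcongr
    rw [ENNReal.ofReal_add (by norm_num) hδ.le, add_mul, ENNReal.ofReal_one, one_mul]
    gcongr
  · refine le_trans ?_ le_add_self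
    gcongr
    rw [ENNReal.ofReal_add (by norm_num) hδi.le, add_mul, ENNReal.ofReal_one, one_mul, add_comm]
    gcongr
    calc a = ENNReal.ofReal δ⁻¹ * (ENNReal.ofReal δ * a) := by
          rw [← mul_assoc, ← ENNReal.ofReal_mul hδi.le, inv_mul_cancel₀ hδ.ne']; simp
      _ ≤ _ := by gcongr

lemma w_mul (p : ℝ) {c u : ℝ} (hc : 0 ≤ c) (hu : 0 ≤ u) :
    ENNReal.ofReal ((c * u) ^ (1 / p)) = ENNReal.ofReal (c ^ (1 / p)) * ENNReal.ofReal (u ^ (1 / p)) := by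
  rw [Real.mul_rpow hc hu, ENNReal.ofReal_mul (by positivity)]

/-- scaling of the power integral -/
lemma wint_scale (p ρ : ℝ) (hρ : 0 < ρ) {T : ℝ} (hT : 0 < T) :
    ∫⁻ u in Ioo 0 T, ENNReal.ofReal (u ^ (1 / p)) ^ ρ / ENNReal.ofReal u =
      ENNReal.ofReal (T ^ (1 / p)) ^ ρ *
        ∫⁻ u in Ioo (0:ℝ) 1, ENNReal.ofReal (u ^ (1 / p)) ^ ρ / ENNReal.ofReal u := by
  have h := lintegral_scale (fun u => ENNReal.ofReal (u ^ (1 / p)) ^ ρ) hT 1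
  rw [mul_one] at h
  rw [← h, ← lintegral_const_mul' _ _ (by finiteness)]
  refine setLIntegral_congr_fun measurableSet_Ioo fun u hu => ?_
  rw [w_mul p hT.le hu.1.le, ENNReal.mul_rpow_of_nonneg _ _ hρ.le, mul_div_assoc]

lemma wint_ne_top {p ρ : ℝ} (hp : 0 < p) (hρ : 0 < ρ) :
    ∫⁻ u in Ioo (0:ℝ) 1, ENNReal.ofReal (u ^ (1 / p)) ^ ρ / ENNReal.ofReal u ≠ ∞ := by
  have hi : IntegrableOn (fun u : ℝ => u ^ (ρ / p - 1)) (Ioo 0 1) :=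
    (intervalIntegral.integrableOn_Ioo_rpow_iff (by norm_num)).2 (by
      have : 0 < ρ / p := by positivity
      linarith)
  have h2 := hi.lintegral_lt_top
  refine (lt_of_le_of_lt (le_of_eq ?_) h2).ne
  refine setLIntegral_congr_fun measurableSet_Ioo fun u hu => ?_
  rw [ENNReal.ofReal_rpow_of_nonneg (by have := hu.1; positivity) hρ.le,
    ← ENNReal.ofReal_div_of_pos hu.1, ← Real.rpow_mul hu.1.le, Real.rpow_sub_one hu.1.ne']
  congr 3
  ring

lemma wint_ne_zero (p ρ : ℝ) :
    ∫⁻ u in Ioo (0:ℝ) 1, ENNReal.ofReal (u ^ (1 / p)) ^ ρ / ENNReal.ofReal u ≠ 0 := by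
  have hmeas : Measurable fun u : ℝ => ENNReal.ofReal (u ^ (1 / p)) ^ ρ / ENNReal.ofReal u := by
    fun_prop
  refine (setLIntegral_pos_iff hmeas).2 ?_ |>.ne'
  have : Ioo (0:ℝ) 1 ⊆ Function.support (fun u : ℝ => ENNReal.ofReal (u ^ (1 / p)) ^ ρ / ENNReal.ofReal u) ∩ Ioo 0 1 := by
    intro u hu
    refine ⟨?_, hu⟩
    have h1 : 0 < u ^ (1 / p) := Real.rpow_pos_of_pos hu.1 _
    have h2 : ENNReal.ofReal (u ^ (1 / p)) ^ ρ ≠ 0 := by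
      have := ENNReal.rpow_pos (p := ρ) (ENNReal.ofReal_pos.2 h1) ENNReal.ofReal_ne_top
      exact this.ne'
    simp only [Function.mem_support]
    exact (ENNReal.div_pos h2 (by simp)).ne'
  refine lt_of_lt_of_le ?_ (measure_mono this)
  simp

lemma F_log {K V : ℝ} (hK : 0 < K) (hV : 0 < V) : ∃ K' : ℝ, 0 < K' ∧ ∀ F g : ℝ → ℝ≥0∞,
    Antitone g → (∀ u, 0 < u → F u ≤ F (2 * u) + ENNReal.ofReal K * g (u / 2)) →
    (∀ u, V ≤ u → F u = 0) → ∀ t ∈ Ioo (0:ℝ) 1,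
      F t ≤ ENNReal.ofReal (K' * (1 - Real.log t)) * g (t / 2) := by
  have hl2 : 0 < Real.log 2 := Real.log_pos (by norm_num)
  refine ⟨(|Real.log V| / Real.log 2 + 1 / Real.log 2 + 1) * K, by positivity, ?_⟩
  intro F g hg hkey hFV t ht
  have hlt : Real.log t < 0 := Real.log_neg ht.1 ht.2
  have ind : ∀ n : ℕ, F t ≤ F (2 ^ n * t) + n * (ENNReal.ofReal K * g (t / 2)) := by
    intro n
    induction n with
    | zero => simp
    | succ n ih =>
      refine ih.trans ?_
      have h1 : 0 < 2 ^ n * t := by have := ht.1; positivity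
      have h2 := hkey _ h1
      have h3 : g (2 ^ n * t / 2) ≤ g (t / 2) := by
        apply hg
        have : (1:ℝ) ≤ 2 ^ n := one_le_pow₀ (by norm_num)
        have := ht.1
        gcongr
        nlinarith
      calc F (2 ^ n * t) + n * (ENNReal.ofReal K * g (t / 2))
          ≤ (F (2 * (2 ^ n * t)) + ENNReal.ofReal K * g (t / 2)) + n * (ENNReal.ofReal K * g (t / 2)) := by
            gcongr
            exact h2.trans (by gcongr)
        _ = _ := by
          rw [show 2 * (2 ^ n * t) = 2 ^ (n+1) * t by ring]; push_cast; ring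
  set x := (|Real.log V| - Real.log t) / Real.log 2 with hx
  have hx0 : 0 ≤ x := by
    have := abs_nonneg (Real.log V)
    apply div_nonneg _ hl2.le
    linarith
  have hn := Nat.le_ceil x
  have hn2 := Nat.ceil_lt_add_one hx0
  set n := ⌈x⌉₊
  have hz : F (2 ^ n * t) = 0 := by
    apply hFV
    rw [← Real.log_le_log_iff hV (by have := ht.1; positivity), Real.log_mul (by positivity) ht.1.ne',
      Real.log_pow]
    rw [hx, div_le_iff₀ hl2] at hn
    have := le_abs_self (Real.log V)
    linarith
  have := ind n
  rw [hz, zero_add] at this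
  refine this.trans ?_
  rw [← mul_assoc]
  gcongr
  rw [← ENNReal.ofReal_natCast, ← ENNReal.ofReal_mul (by positivity)]
  apply ENNReal.ofReal_le_ofReal
  have h5 : (n:ℝ) ≤ (|Real.log V| / Real.log 2 + 1 / Real.log 2 + 1) * (1 - Real.log t) := by
    have e : x = |Real.log V| / Real.log 2 + (1 / Real.log 2) * (- Real.log t) := by
      rw [hx]; field_simp; ring
    have a1 : 0 ≤ |Real.log V| / Real.log 2 := by positivity
    have a2 : 0 ≤ 1 / Real.log 2 := by positivity
    nlinarith [mul_nonneg a1 (neg_nonneg.2 hlt.le)]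
  nlinarith

/-- Hardy type inequality with finite exponent. -/
lemma hardy_fin {K p ρ : ℝ} (hK : 0 < K) (hp : 0 < p) (hρ : 0 < ρ) : ∃ C : ℝ≥0∞, C ≠ ∞ ∧
    ∀ H g : ℝ → ℝ≥0∞, ∀ t : ℝ, 0 < t → Antitone H → Antitone g →
    (∀ u, 0 < u → H u ≤ H (2 * u) + ENNReal.ofReal K * g (u / 2)) →
    (∀ u, t ≤ u → H u = 0) →
    ∫⁻ u in Ioo 0 t, (ENNReal.ofReal (u ^ (1 / p)) * H u) ^ ρ / ENNReal.ofReal u ≠ ∞ →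
    ∫⁻ u in Ioo 0 t, (ENNReal.ofReal (u ^ (1 / p)) * H u) ^ ρ / ENNReal.ofReal u ≤
      C * ∫⁻ u in Ioo 0 t, (ENNReal.ofReal (u ^ (1 / p)) * g u) ^ ρ / ENNReal.ofReal u := by
  set q : ℝ := 2 ^ (1 / p / 2) with hq
  have hq1 : 1 < q := Real.one_lt_rpow (by norm_num) (by positivity)
  have hq0 : 0 < q := by linarith
  have hqq : (2:ℝ) ^ (1 / p) = q * q := by
    rw [hq, ← Real.rpow_add (by norm_num)]; congr 1; ring
  set δ := q - 1 with hδdef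
  have hδ : 0 < δ := by linarith
  set B := 1 + δ⁻¹ with hB
  have hB0 : 0 < B := by positivity
  set θ := (q⁻¹) ^ ρ with hθ
  have hθ1 : θ < 1 := Real.rpow_lt_one (by positivity) (inv_lt_one_of_one_lt₀ hq1) hρ
  refine ⟨ENNReal.ofReal (1 - θ)⁻¹ * ENNReal.ofReal (B * K * (q * q)) ^ ρ, by finiteness, ?_⟩
  intro H g t ht hH hg hkey hHt hfin
  set w : ℝ → ℝ≥0∞ := fun u => ENNReal.ofReal (u ^ (1 / p)) with hw
  have hHm : Measurable H := hH.measurable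
  have hgm : Measurable g := hg.measurable
  have hwm : Measurable w := by fun_prop
  rw [mul_assoc]
  apply absorb (by positivity) hθ1 hfin
  have pw : ∀ u ∈ Ioo 0 t, (w u * H u) ^ ρ / ENNReal.ofReal u ≤
      ENNReal.ofReal θ * ((w (2 * u) * H (2 * u)) ^ ρ / ENNReal.ofReal u) +
      ENNReal.ofReal (B * K * (q * q)) ^ ρ * ((w (1/2 * u) * g (1/2 * u)) ^ ρ / ENNReal.ofReal u) := by
    intro u hu
    have hu0 := hu.1
    have h1 : w u * H u ≤ w u * H (2 * u) + w u * (ENNReal.ofReal K * g (u / 2)) := by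
      rw [← mul_add]; gcongr; exact hkey u hu0
    have h2 := (ENNReal.rpow_le_rpow h1 hρ.le).trans (add_rpow_split _ _ hδ hρ)
    have e1 : (ENNReal.ofReal (1 + δ) * (w u * H (2 * u))) ^ ρ =
        ENNReal.ofReal θ * (w (2 * u) * H (2 * u)) ^ ρ := by
      rw [hθ, ← ENNReal.ofReal_rpow_of_pos (by positivity), ← ENNReal.mul_rpow_of_nonneg _ _ hρ.le]
      congr 1
      simp only [hw]
      have e0 : ENNReal.ofReal (1 + δ) = ENNReal.ofReal q⁻¹ * ENNReal.ofReal (q * q) := by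
        rw [← ENNReal.ofReal_mul (by positivity)]
        congr 1
        rw [hδdef]; field_simp; ring
      rw [w_mul p (by norm_num) hu0.le, hqq, e0]
      ring
    have e2 : (ENNReal.ofReal (1 + δ⁻¹) * (w u * (ENNReal.ofReal K * g (u / 2)))) ^ ρ =
        ENNReal.ofReal (B * K * (q * q)) ^ ρ * (w (1/2 * u) * g (1/2 * u)) ^ ρ := by
      rw [← ENNReal.mul_rpow_of_nonneg _ _ hρ.le]
      congr 1
      have : w u = ENNReal.ofReal (q * q) * w (1/2 * u) := by
        simp only [hw]
        rw [← hqq, ← w_mul p (by norm_num) (by positivity)]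
        congr 2; ring
      rw [this, ← hB, ENNReal.ofReal_mul (p := B * K) (by positivity), ENNReal.ofReal_mul (p := B) (by positivity),
        show u / 2 = 1/2 * u by ring]
      ring
    rw [e1, e2] at h2
    rw [← mul_div_assoc, ← mul_div_assoc, ← ENNReal.add_div]
    gcongr
  calc _ ≤ ∫⁻ u in Ioo 0 t, (ENNReal.ofReal θ * ((w (2 * u) * H (2 * u)) ^ ρ / ENNReal.ofReal u) +
      ENNReal.ofReal (B * K * (q * q)) ^ ρ * ((w (1/2 * u) * g (1/2 * u)) ^ ρ / ENNReal.ofReal u)) :=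
        setLIntegral_mono' measurableSet_Ioo pw
    _ = (ENNReal.ofReal θ * ∫⁻ u in Ioo 0 (2 * t), (w u * H u) ^ ρ / ENNReal.ofReal u) +
        ENNReal.ofReal (B * K * (q * q)) ^ ρ * ∫⁻ u in Ioo 0 (1/2 * t), (w u * g u) ^ ρ / ENNReal.ofReal u := by
      rw [lintegral_add_left (by fun_prop), lintegral_const_mul' _ _ (by finiteness),
        lintegral_const_mul' _ _ (by finiteness),
        lintegral_scale (fun u => (w u * H u) ^ ρ) (by norm_num),
        lintegral_scale (fun u => (w u * g u) ^ ρ) (by norm_num)]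
    _ ≤ _ := by
      refine add_le_add (mul_le_mul_right ?_ _) (mul_le_mul_right ?_ _)
      · have hsub : Ioo 0 (2 * t) ⊆ Ioo 0 t ∪ Ico t (2 * t) := by
          intro u hu
          rcases lt_or_ge u t with h | h
          · exact Or.inl ⟨hu.1, h⟩
          · exact Or.inr ⟨h, hu.2⟩
        refine (lintegral_mono_set hsub).trans ((lintegral_union_le _ _ _).trans ?_)
        have : ∫⁻ u in Ico t (2 * t), (w u * H u) ^ ρ / ENNReal.ofReal u = 0 := by
          rw [← lintegral_zero (μ := volume.restrict (Ico t (2*t)))]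
          refine setLIntegral_congr_fun measurableSet_Ico fun u hu => ?_
          rw [hHt u hu.1, mul_zero, ENNReal.zero_rpow_of_pos hρ, ENNReal.zero_div]
        rw [this, add_zero]
      · exact lintegral_mono_set (Ioo_subset_Ioo_right (by linarith))

/-- Hardy type inequality, sup version. -/
lemma hardy_sup {K p : ℝ} (hK : 0 < K) (hp : 0 < p) : ∃ C : ℝ≥0∞, C ≠ ∞ ∧
    ∀ H g : ℝ → ℝ≥0∞, ∀ t : ℝ, 0 < t →
    (∀ u, 0 < u → H u ≤ H (2 * u) + ENNReal.ofReal K * g (u / 2)) →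
    (∀ u, t ≤ u → H u = 0) →
    (⨆ u ∈ Ioo 0 t, ENNReal.ofReal (u ^ (1 / p)) * H u) ≠ ∞ →
    (⨆ u ∈ Ioo 0 t, ENNReal.ofReal (u ^ (1 / p)) * H u) ≤
      C * ⨆ u ∈ Ioo 0 t, ENNReal.ofReal (u ^ (1 / p)) * g u := by
  set q : ℝ := 2 ^ (1 / p) with hq
  have hq1 : 1 < q := Real.one_lt_rpow (by norm_num) (by positivity)
  have hq0 : 0 < q := by linarith
  refine ⟨ENNReal.ofReal (1 - q⁻¹)⁻¹ * ENNReal.ofReal (K * q), by finiteness, ?_⟩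
  intro H g t ht hkey hHt hfin
  rw [mul_assoc]
  apply absorb (by positivity) (inv_lt_one_of_one_lt₀ hq1) hfin
  refine iSup₂_le fun u hu => ?_
  have hu0 := hu.1
  calc ENNReal.ofReal (u ^ (1 / p)) * H u
      ≤ ENNReal.ofReal (u ^ (1 / p)) * (H (2 * u) + ENNReal.ofReal K * g (u / 2)) := by
        gcongr; exact hkey u hu0
    _ = ENNReal.ofReal q⁻¹ * (ENNReal.ofReal ((2 * u) ^ (1 / p)) * H (2 * u)) +
        ENNReal.ofReal (K * q) * (ENNReal.ofReal ((u / 2) ^ (1 / p)) * g (u / 2)) := by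
      have e1 : ENNReal.ofReal (u ^ (1 / p)) = ENNReal.ofReal q⁻¹ * ENNReal.ofReal ((2 * u) ^ (1 / p)) := by
        rw [w_mul p (by norm_num) hu0.le, ← mul_assoc, ← ENNReal.ofReal_mul (by positivity),
          inv_mul_cancel₀ hq0.ne']; simp
      have e2 : ENNReal.ofReal (u ^ (1 / p)) = ENNReal.ofReal q * ENNReal.ofReal ((u / 2) ^ (1 / p)) := by
        rw [hq, ← w_mul p (by norm_num) (by positivity)]
        congr 2; ring
      rw [mul_add, ENNReal.ofReal_mul hK.le]
      conv_lhs => rw [← mul_assoc]; arg 1; rw [e1]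
      conv_lhs => arg 2; rw [e2]
      ring
    _ ≤ _ := by
      refine add_le_add (mul_le_mul_right ?_ _) (mul_le_mul_right ?_ _)
      · rcases lt_or_ge (2 * u) t with h | h
        · exact le_iSup₂_of_le (2 * u) ⟨by positivity, h⟩ le_rfl
        · rw [hHt _ h, mul_zero]; exact zero_le
      · exact le_iSup₂_of_le (u / 2) ⟨by positivity, by linarith [hu.2]⟩ le_rfl


lemma tau_facts {p lam t : ℝ} (hp : 0 < p) (hpl : p ≤ lam) (ht : t ∈ Ioo (0:ℝ) 1) :
    0 < t * (1 - Real.log t) ^ (-lam) ∧ t * (1 - Real.log t) ^ (-lam) ≤ t ∧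
    (t * (1 - Real.log t) ^ (-lam)) ^ (1 / p) * (1 - Real.log t) ≤ t ^ (1 / p) := by
  have hlt : Real.log t < 0 := Real.log_neg ht.1 ht.2
  have h0 := ht.1
  have hB : 1 ≤ 1 - Real.log t := by linarith
  have hB0 : 0 < 1 - Real.log t := by linarith
  set B := 1 - Real.log t
  refine ⟨by positivity, ?_, ?_⟩
  · have : B ^ (-lam) ≤ 1 := Real.rpow_le_one_of_one_le_of_nonpos hB (by linarith)
    nlinarith
  · rw [Real.mul_rpow h0.le (by positivity), ← Real.rpow_mul hB0.le, mul_assoc,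
      ← Real.rpow_add_one hB0.ne']
    have h2 : B ^ (-lam * (1 / p) + 1) ≤ 1 := by
      apply Real.rpow_le_one_of_one_le_of_nonpos hB
      have : 1 ≤ lam * (1 / p) := by
        rw [mul_one_div, le_div_iff₀ hp]; linarith
      linarith
    have : 0 ≤ t ^ (1 / p) := by positivity
    nlinarith

lemma oneD {K V p lam : ℝ} {r : ℝ≥0∞} (hK : 0 < K) (hV : 0 < V) (hp : 0 < p) (hr : 0 < r)
    (hpl : p ≤ lam) : ∃ C : ℝ≥0∞, C ≠ ∞ ∧ ∀ F g : ℝ → ℝ≥0∞, Antitone F → Antitone g →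
    (∀ u, 0 < u → F u ≤ F (2 * u) + ENNReal.ofReal K * g (u / 2)) →
    (∀ u, V ≤ u → F u = 0) →
    qint r (Ioo 0 1) (fun u => ENNReal.ofReal (u ^ (1 / p)) * F u) ≠ ∞ →
    ∀ t ∈ Ioo (0:ℝ) 1,
      qint r (Ioo 0 (t * (1 - Real.log t) ^ (-lam))) (fun u => ENNReal.ofReal (u ^ (1 / p)) * F u) ≤
        C * qint r (Ioo 0 t) (fun u => ENNReal.ofReal (u ^ (1 / p)) * g u) := by
  obtain ⟨K', hK', hlog⟩ := F_log hK hV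
  have Hprop : ∀ F g : ℝ → ℝ≥0∞, Antitone F →
      (∀ u, 0 < u → F u ≤ F (2 * u) + ENNReal.ofReal K * g (u / 2)) → ∀ t,
      (∀ u, 0 < u → (F u - F t) ≤ (F (2 * u) - F t) + ENNReal.ofReal K * g (u / 2)) ∧
      (∀ u, t ≤ u → F u - F t = 0) := by
    intro F g hF hkey t
    refine ⟨fun u hu => ?_, fun u hu => tsub_eq_zero_of_le (hF hu)⟩
    rw [tsub_le_iff_right]
    calc F u ≤ F (2 * u) + ENNReal.ofReal K * g (u / 2) := hkey u hu
      _ ≤ (F (2 * u) - F t + F t) + ENNReal.ofReal K * g (u / 2) := by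
        gcongr; exact le_tsub_add
      _ = _ := by ring
  set q : ℝ := 2 ^ (1 / p) with hq
  have hq0 : 0 < q := by positivity
  have wt : ∀ t, 0 < t → ENNReal.ofReal (t ^ (1 / p)) = ENNReal.ofReal q * ENNReal.ofReal ((t / 2) ^ (1 / p)) := by
    intro t ht
    rw [hq, ← w_mul p (by norm_num) (by positivity)]
    congr 2; ring
  -- the key bound on w τ * F t
  have wF : ∀ F g : ℝ → ℝ≥0∞, Antitone g →
      (∀ u, 0 < u → F u ≤ F (2 * u) + ENNReal.ofReal K * g (u / 2)) →
      (∀ u, V ≤ u → F u = 0) → ∀ t ∈ Ioo (0:ℝ) 1,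
      ENNReal.ofReal ((t * (1 - Real.log t) ^ (-lam)) ^ (1 / p)) * F t ≤
        ENNReal.ofReal (K' * q) * (ENNReal.ofReal ((t / 2) ^ (1 / p)) * g (t / 2)) := by
    intro F g hg hkey hFV t ht
    obtain ⟨h1, h2, h3⟩ := tau_facts hp hpl ht
    calc _ ≤ ENNReal.ofReal ((t * (1 - Real.log t) ^ (-lam)) ^ (1 / p)) *
          (ENNReal.ofReal (K' * (1 - Real.log t)) * g (t / 2)) := by
          gcongr; exact hlog F g hg hkey hFV t ht
      _ = ENNReal.ofReal K' * ENNReal.ofReal ((t * (1 - Real.log t) ^ (-lam)) ^ (1 / p) * (1 - Real.log t)) * g (t / 2) := by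
          rw [ENNReal.ofReal_mul hK'.le, ENNReal.ofReal_mul (q := 1 - Real.log t) (by positivity)]
          ring
      _ ≤ ENNReal.ofReal K' * ENNReal.ofReal (t ^ (1 / p)) * g (t / 2) := by gcongr
      _ = _ := by
          rw [wt t ht.1, ENNReal.ofReal_mul hK'.le]; ring
  by_cases hrt : r = ∞
  · subst hrt
    obtain ⟨C, hC, hh⟩ := hardy_sup hK hp
    refine ⟨C + ENNReal.ofReal (K' * q), by finiteness, ?_⟩
    intro F g hF hg hkey hFV hfin t ht
    simp only [qint, if_true] at hfin ⊢
    obtain ⟨k1, k2⟩ := Hprop F g hF hkey t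
    obtain ⟨h1, h2, h3⟩ := tau_facts hp hpl ht
    have hfinH : (⨆ u ∈ Ioo 0 t, ENNReal.ofReal (u ^ (1 / p)) * (F u - F t)) ≠ ∞ := by
      refine ne_top_of_le_ne_top hfin (iSup₂_le fun u hu => ?_)
      refine le_trans ?_ (le_iSup₂ (f := fun u (_ : u ∈ Ioo (0:ℝ) 1) => ENNReal.ofReal (u ^ (1 / p)) * F u) u
        ⟨hu.1, hu.2.trans ht.2⟩)
      gcongr
      exact tsub_le_self
    have hH := hh (fun u => F u - F t) g t ht.1 k1 k2 hfinH
    refine iSup₂_le fun u hu => ?_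
    have hut : u < t := hu.2.trans_le h2
    rw [add_mul]
    calc ENNReal.ofReal (u ^ (1 / p)) * F u ≤ ENNReal.ofReal (u ^ (1 / p)) * ((F u - F t) + F t) := by
          gcongr; exact le_tsub_add
      _ = ENNReal.ofReal (u ^ (1 / p)) * (F u - F t) + ENNReal.ofReal (u ^ (1 / p)) * F t := mul_add _ _ _
      _ ≤ _ := by
        refine add_le_add ?_ ?_
        · exact le_trans (le_iSup₂ (f := fun u (_ : u ∈ Ioo (0:ℝ) t) => ENNReal.ofReal (u ^ (1 / p)) * (F u - F t)) u
            ⟨hu.1, hut⟩) hH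
        · have : ENNReal.ofReal (u ^ (1 / p)) ≤ ENNReal.ofReal ((t * (1 - Real.log t) ^ (-lam)) ^ (1 / p)) :=
            ENNReal.ofReal_le_ofReal (Real.rpow_le_rpow hu.1.le hu.2.le (by positivity))
          refine (mul_le_mul_left this _).trans ((wF F g hg hkey hFV t ht).trans ?_)
          refine mul_le_mul_right ?_ _
          exact le_iSup₂ (f := fun u (_ : u ∈ Ioo (0:ℝ) t) => ENNReal.ofReal (u ^ (1 / p)) * g u) (t / 2)
            ⟨by linarith [ht.1], by linarith [ht.1]⟩
  · set ρ := r.toReal with hρdef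
    have hρ : 0 < ρ := ENNReal.toReal_pos hr.ne' hrt
    obtain ⟨C, hC, hh⟩ := hardy_fin hK hp hρ
    refine ⟨2 ^ ρ * C + (ENNReal.ofReal (2 * (K' * q))) ^ ρ, by finiteness, ?_⟩
    intro F g hF hg hkey hFV hfin t ht
    simp only [qint, hrt, if_false] at hfin ⊢
    rw [← hρdef] at hfin ⊢
    obtain ⟨k1, k2⟩ := Hprop F g hF hkey t
    obtain ⟨h1, h2, h3⟩ := tau_facts hp hpl ht
    have hHanti : Antitone fun u => F u - F t := fun x y hxy => tsub_le_tsub_right (hF hxy) _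
    have hfinH : ∫⁻ u in Ioo 0 t, (ENNReal.ofReal (u ^ (1 / p)) * (F u - F t)) ^ ρ / ENNReal.ofReal u ≠ ∞ := by
      refine ne_top_of_le_ne_top hfin ?_
      refine (lintegral_mono_set (Ioo_subset_Ioo_right ht.2.le)).trans ?_
      refine lintegral_mono fun u => ?_
      gcongr
      exact tsub_le_self
    have hH := hh (fun u => F u - F t) g t ht.1 hHanti hg k1 k2 hfinH
    set τ := t * (1 - Real.log t) ^ (-lam) with hτ
    set w : ℝ → ℝ≥0∞ := fun u => ENNReal.ofReal (u ^ (1 / p)) with hw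
    have hwm : Measurable w := by fun_prop
    have hHm : Measurable fun u => F u - F t := hHanti.measurable
    have pw : ∀ u, (w u * F u) ^ ρ / ENNReal.ofReal u ≤
        2 ^ ρ * ((w u * (F u - F t)) ^ ρ / ENNReal.ofReal u) +
        (2 * F t) ^ ρ * (w u ^ ρ / ENNReal.ofReal u) := by
      intro u
      have h1 : w u * F u ≤ w u * (F u - F t) + w u * F t := by
        rw [← mul_add]; gcongr; exact le_tsub_add
      have h2 := (ENNReal.rpow_le_rpow h1 hρ.le).trans (add_rpow_split _ _ (δ := 1) one_pos hρ)
      rw [inv_one, show ENNReal.ofReal (1 + 1) = 2 by norm_num,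
        ENNReal.mul_rpow_of_nonneg (2:ℝ≥0∞) (w u * (F u - F t)) hρ.le,
        show 2 * (w u * F t) = (2 * F t) * w u by ring, ENNReal.mul_rpow_of_nonneg (2 * F t) _ hρ.le] at h2
      rw [← mul_div_assoc, ← mul_div_assoc, ← ENNReal.add_div]
      gcongr
    have hgbound : (w (t/2) * g (t/2)) ^ ρ * (∫⁻ u in Ioo (0:ℝ) 1, w u ^ ρ / ENNReal.ofReal u) ≤
        ∫⁻ u in Ioo 0 t, (w u * g u) ^ ρ / ENNReal.ofReal u := by
      have e := wint_scale p ρ hρ (T := t / 2) (by linarith [ht.1])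
      rw [ENNReal.mul_rpow_of_nonneg _ _ hρ.le, mul_right_comm, ← e, mul_comm]
      rw [← lintegral_const_mul _ (by fun_prop)]
      refine le_trans ?_ (lintegral_mono_set (show Ioo (0:ℝ) (t / 2) ⊆ Ioo 0 t from Ioo_subset_Ioo_right (by linarith [ht.1])))
      refine setLIntegral_mono' measurableSet_Ioo fun u hu => ?_
      rw [ENNReal.mul_rpow_of_nonneg _ _ hρ.le, ← mul_div_assoc, mul_comm]
      gcongr
      exact hg hu.2.le
    calc _ ≤ ∫⁻ u in Ioo 0 τ, (2 ^ ρ * ((w u * (F u - F t)) ^ ρ / ENNReal.ofReal u) +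
        (2 * F t) ^ ρ * (w u ^ ρ / ENNReal.ofReal u)) := lintegral_mono fun u => pw u
      _ = 2 ^ ρ * (∫⁻ u in Ioo 0 τ, (w u * (F u - F t)) ^ ρ / ENNReal.ofReal u) +
          (2 * F t) ^ ρ * ∫⁻ u in Ioo 0 τ, w u ^ ρ / ENNReal.ofReal u := by
        rw [lintegral_add_left (by fun_prop), lintegral_const_mul _ (by fun_prop),
          lintegral_const_mul _ (by fun_prop)]
      _ ≤ 2 ^ ρ * (C * ∫⁻ u in Ioo 0 t, (w u * g u) ^ ρ / ENNReal.ofReal u) +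
          (ENNReal.ofReal (2 * (K' * q))) ^ ρ * ∫⁻ u in Ioo 0 t, (w u * g u) ^ ρ / ENNReal.ofReal u := by
        refine add_le_add (mul_le_mul_right ?_ _) ?_
        · exact (lintegral_mono_set (Ioo_subset_Ioo_right h2)).trans hH
        · rw [wint_scale p ρ hρ h1, ← mul_assoc, ← ENNReal.mul_rpow_of_nonneg _ _ hρ.le]
          have h4 : 2 * F t * ENNReal.ofReal (τ ^ (1 / p)) ≤
              ENNReal.ofReal (2 * (K' * q)) * (w (t/2) * g (t/2)) := by
            rw [ENNReal.ofReal_mul (by norm_num), show ENNReal.ofReal 2 = 2 by simp, mul_assoc, mul_assoc,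
              mul_comm (F t)]
            exact mul_le_mul_right (wF F g hg hkey hFV t ht) _
          refine (mul_le_mul_left (ENNReal.rpow_le_rpow h4 hρ.le) _).trans ?_
          rw [ENNReal.mul_rpow_of_nonneg _ _ hρ.le, mul_assoc]
          exact mul_le_mul_right hgbound _
      _ = _ := by rw [add_mul, mul_assoc]

lemma fin_of_lorentz {p : ℝ} {r : ℝ≥0∞} (hp : 0 < p) (hr : 0 < r) {F0 F : ℝ → ℝ≥0∞} {M : ℝ≥0∞}
    (hM : M ≠ ∞) (hF0 : Antitone F0) (hle : ∀ u, F u ≤ F0 u + M)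
    (h : qnorm r (Ioo 0 1) (fun u => ENNReal.ofReal (u ^ (1 / p)) * F0 u) ≠ ∞) :
    qint r (Ioo 0 1) (fun u => ENNReal.ofReal (u ^ (1 / p)) * F u) ≠ ∞ := by
  by_cases hrt : r = ∞
  · subst hrt
    simp only [qnorm, qint, if_true] at h ⊢
    refine ne_top_of_le_ne_top (ENNReal.add_ne_top.2 ⟨h, hM⟩) (iSup₂_le fun u hu => ?_)
    calc _ ≤ ENNReal.ofReal (u ^ (1 / p)) * (F0 u + M) := by gcongr; exact hle u
      _ = ENNReal.ofReal (u ^ (1 / p)) * F0 u + ENNReal.ofReal (u ^ (1 / p)) * M := mul_add _ _ _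
      _ ≤ _ := by
        refine add_le_add (le_iSup₂ (f := fun u (_ : u ∈ Ioo (0:ℝ) 1) => ENNReal.ofReal (u ^ (1 / p)) * F0 u) u hu) ?_
        refine mul_le_of_le_one_left' ?_
        rw [ENNReal.ofReal_le_one]
        exact Real.rpow_le_one hu.1.le hu.2.le (by positivity)
  · simp only [qnorm, qint, hrt, if_false] at h ⊢
    set ρ := r.toReal with hρdef
    have hρ : 0 < ρ := ENNReal.toReal_pos hr.ne' hrt
    have h' : ∫⁻ u in Ioo (0:ℝ) 1, (ENNReal.ofReal (u ^ (1 / p)) * F0 u) ^ ρ / ENNReal.ofReal u ≠ ∞ := by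
      intro hh
      rw [hh] at h
      exact h (ENNReal.top_rpow_of_pos (by positivity))
    set w : ℝ → ℝ≥0∞ := fun u => ENNReal.ofReal (u ^ (1 / p)) with hw
    have hwm : Measurable w := by fun_prop
    have hF0m : Measurable F0 := hF0.measurable
    have pw : ∀ u, (w u * F u) ^ ρ / ENNReal.ofReal u ≤
        2 ^ ρ * ((w u * F0 u) ^ ρ / ENNReal.ofReal u) +
        (2 * M) ^ ρ * (w u ^ ρ / ENNReal.ofReal u) := by
      intro u
      have h1 : w u * F u ≤ w u * F0 u + w u * M := by
        rw [← mul_add]; gcongr; exact hle u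
      have h2 := (ENNReal.rpow_le_rpow h1 hρ.le).trans (add_rpow_split _ _ (δ := 1) one_pos hρ)
      rw [inv_one, show ENNReal.ofReal (1 + 1) = 2 by norm_num,
        ENNReal.mul_rpow_of_nonneg (2:ℝ≥0∞) (w u * F0 u) hρ.le,
        show 2 * (w u * M) = (2 * M) * w u by ring, ENNReal.mul_rpow_of_nonneg (2 * M) _ hρ.le] at h2
      rw [← mul_div_assoc, ← mul_div_assoc, ← ENNReal.add_div]
      gcongr
    refine ne_top_of_le_ne_top ?_ (lintegral_mono fun u => pw u)
    rw [lintegral_add_left (by fun_prop), lintegral_const_mul _ (by fun_prop),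
      lintegral_const_mul _ (by fun_prop)]
    have := wint_ne_top hp hρ
    exact ENNReal.add_ne_top.2 ⟨ENNReal.mul_ne_top (by finiteness) h', ENNReal.mul_ne_top (by finiteness) this⟩

lemma sufficiency {d : ℕ} {Q0 : Set (Euc d)} (hQ0 : IsCube Q0)
    {p : ℝ} (hp : 0 < p) {r : ℝ≥0∞} (hr : 0 < r) {lam : ℝ} (hpl : p ≤ lam) :
    ∃ C : ℝ, 0 < C ∧ ∀ f : Euc d → ℝ, Measurable f → IntegrableOn f Q0 volume →
      lorentz (volume.restrict Q0) f p r (Set.Ioo 0 1) ≠ ∞ →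
      ∀ t ∈ Set.Ioo (0 : ℝ) 1,
        qint r (Set.Ioo 0 (t * (1 - Real.log t) ^ (-lam)))
            (fun u => ENNReal.ofReal (u ^ (1 / p)) *
              rearrR (volume.restrict Q0) (fun x => f x - ⨍ z in Q0, f z) u) ≤
          ENNReal.ofReal C *
            qint r (Set.Ioo 0 t)
              (fun u => ENNReal.ofReal (u ^ (1 / p)) *
                rearr (volume.restrict Q0) (sharpLocal volume Q0 f) u) := by
  obtain ⟨a, l, hl, rfl⟩ := hQ0
  obtain ⟨C, hC, h⟩ := oneD (K := 2 + 4 * (4 * 2 ^ d)) (V := l ^ d) (p := p) (lam := lam) (r := r)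
    (by positivity) (by positivity) hp hr hpl
  refine ⟨C.toReal + 1, by positivity, fun f hfm hf hlor t ht => ?_⟩
  have h1 := h _ _ (rearr_antitone _ _) (rearr_antitone (volume.restrict (cubeSet a l)) (sharpLocal volume (cubeSet a l) f))
    (fun u hu => key_rearr a hl hfm hf hu) (fun u hu => ?_)
    (fin_of_lorentz hp hr (M := ENNReal.ofReal |⨍ z in cubeSet a l, f z|) (by finiteness)
      (rearr_antitone _ _) (fun u => rearrR_sub_le _ f _ u) hlor) t ht
  · refine h1.trans (mul_le_mul_left ?_ _)
    rw [← ENNReal.ofReal_toReal hC]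
    exact ENNReal.ofReal_le_ofReal (by simp)
  · refine rearrR_zero_of_ge _ ?_
    rw [volume_cubeSet, ← ENNReal.ofReal_pow hl.le]
    exact ENNReal.ofReal_le_ofReal hu


/-- The truncated dyadic logarithm: sum of indicators of corner cubes. -/
def logF {d : ℕ} (a : Fin d → ℝ) (l : ℝ) (N : ℕ) (x : Euc d) : ℝ :=
  ∑ k ∈ Finset.range N, (cubeSet a (l / 2 ^ k)).indicator (fun _ => (1:ℝ)) x

lemma logF_measurable {d : ℕ} (a : Fin d → ℝ) (l : ℝ) (N : ℕ) : Measurable (logF a l N) := by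
  unfold logF
  exact Finset.measurable_sum _ fun k _ => measurable_const.indicator (measurableSet_cubeSet _ _)

lemma logF_nonneg {d : ℕ} (a : Fin d → ℝ) (l : ℝ) (N : ℕ) (x : Euc d) : 0 ≤ logF a l N x :=
  Finset.sum_nonneg fun k _ => Set.indicator_nonneg (fun _ _ => zero_le_one) x

lemma logF_le {d : ℕ} (a : Fin d → ℝ) (l : ℝ) (N : ℕ) (x : Euc d) : logF a l N x ≤ N := by
  unfold logF
  calc _ ≤ ∑ k ∈ Finset.range N, (1:ℝ) := Finset.sum_le_sum fun k _ =>
        Set.indicator_le_self' (fun _ _ => zero_le_one) x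
    _ = N := by simp

lemma cubeSet_mono {d : ℕ} (a : Fin d → ℝ) {l l' : ℝ} (h : l ≤ l') : cubeSet a l ⊆ cubeSet a l' :=
  fun _ hx i => ⟨(hx i).1, (hx i).2.trans (by linarith)⟩

lemma logF_eq {d : ℕ} (a : Fin d → ℝ) {l : ℝ} (hl : 0 < l) (N : ℕ) {x : Euc d}
    (hx : x ∈ cubeSet a (l / 2 ^ N)) : logF a l N x = N := by
  unfold logF
  have : ∀ k ∈ Finset.range N, (cubeSet a (l / 2 ^ k)).indicator (fun _ => (1:ℝ)) x = 1 := by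
    intro k hk
    refine Set.indicator_of_mem (cubeSet_mono a ?_ hx) _
    have := (Finset.mem_range.1 hk).le
    gcongr
    norm_num
  rw [Finset.sum_congr rfl this]; simp

lemma logF_integrableOn {d : ℕ} (a : Fin d → ℝ) (l : ℝ) (N : ℕ) {Q : Set (Euc d)}
    (hQ : volume Q ≠ ∞) : IntegrableOn (logF a l N) Q volume := by
  have : Fact (volume Q < ∞) := ⟨hQ.lt_top⟩
  refine Integrable.of_bound (C := (N:ℝ)) (logF_measurable a l N).aestronglyMeasurable
    (Eventually.of_forall fun x => ?_)
  rw [Real.norm_eq_abs, abs_of_nonneg (logF_nonneg a l N x)]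
  exact logF_le a l N x

lemma slice_volume {d : ℕ} (b : Fin d → ℝ) {h : ℝ} (hh : 0 < h) (i : Fin d) {ε : ℝ} (hε : 0 ≤ ε)
    {S : Set (Euc d)} (hS : ∀ x ∈ S, x ∈ cubeSet b h ∧ x i ≤ b i + h * ε) :
    volume.real S ≤ ε * h ^ d := by
  have hsub : S ⊆ (@WithLp.ofLp 2 (Fin d → ℝ)) ⁻¹'
      (Set.pi univ fun j => Icc (b j) (b j + h * (if j = i then ε else 1))) := by
    intro x hx
    obtain ⟨h1, h2⟩ := hS x hx
    simp only [Set.mem_pi, Set.mem_preimage, Set.mem_univ, forall_true_left, Set.mem_Icc]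
    intro j
    refine ⟨(h1 j).1, ?_⟩
    split_ifs with hj
    · rw [hj]; exact h2
    · rw [mul_one]; exact (h1 j).2
  have h3 : volume S ≤ ENNReal.ofReal (ε * h ^ d) := by
    refine (measure_mono hsub).trans (le_of_eq ?_)
    rw [(PiLp.volume_preserving_ofLp (Fin d)).measure_preimage
      (MeasurableSet.univ_pi fun i => measurableSet_Icc).nullMeasurableSet, volume_pi_pi]
    simp only [Real.volume_Icc, add_sub_cancel_left]
    rw [← ENNReal.ofReal_prod_of_nonneg (fun j _ => by split_ifs <;> positivity),
      Finset.prod_mul_distrib, Finset.prod_ite_eq' ]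
    simp [mul_comm]
  exact ENNReal.toReal_le_of_le_ofReal (by positivity) h3

lemma volReal_cube {d : ℕ} (b : Fin d → ℝ) {h : ℝ} (hh : 0 < h) :
    volume.real (cubeSet b h) = h ^ d := by
  rw [measureReal_def, volume_cubeSet, ENNReal.toReal_pow, ENNReal.toReal_ofReal hh.le]

/-- Oscillation estimate with an explicit integer centre. -/
lemma logF_osc {d : ℕ} (a : Fin d → ℝ) {l : ℝ} (hl : 0 < l) (N : ℕ) (b : Fin d → ℝ) {h : ℝ}
    (hh : 0 < h) (hab : ∀ i, a i ≤ b i) :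
    ∃ k0 : ℕ, (∀ k < k0, k < N → cubeSet b h ⊆ cubeSet a (l / 2 ^ k)) ∧
      ⨍ y in cubeSet b h, |logF a l N y - k0| ≤ 2 := by
  set Q := cubeSet b h with hQ
  have hQfin : volume Q ≠ ∞ := by rw [hQ, volume_cubeSet]; finiteness
  have hV : volume.real Q = h ^ d := volReal_cube b hh
  -- choice of the level
  have hex : ∃ k0 ≤ N, (∀ k < k0, k < N → Q ⊆ cubeSet a (l / 2 ^ k)) ∧
      ∀ j, k0 + j < N → volume.real (Q ∩ cubeSet a (l / 2 ^ (k0 + j))) ≤ (1/2) ^ j * h ^ d := by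
    by_cases hP : ∃ k, k < N ∧ ¬ Q ⊆ cubeSet a (l / 2 ^ k)
    · classical
      refine ⟨Nat.find hP, (Nat.find_spec hP).1.le, fun k hk hkN => ?_, fun j hj => ?_⟩
      · by_contra hc
        exact Nat.find_min hP hk ⟨hkN, hc⟩
      · obtain ⟨hk1, hk2⟩ := Nat.find_spec hP
        set k0 := Nat.find hP
        obtain ⟨x, hx, hx2⟩ := Set.not_subset.1 hk2
        have : ∃ i, a i + l / 2 ^ k0 < x i := by
          by_contra hc
          push Not at hc
          exact hx2 fun i => ⟨(hab i).trans (hx i).1, hc i⟩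
        obtain ⟨i, hi⟩ := this
        refine slice_volume b hh i (by positivity) fun y hy => ⟨hy.1, ?_⟩
        have h1 := (hy.2 i).2
        have h2 := (hx i).2
        have h3 := hab i
        have h4 : l / 2 ^ (k0 + j) = (l / 2 ^ k0) * (1/2) ^ j := by
          rw [pow_add, one_div, inv_pow]; field_simp
        rw [h4] at h1
        have h5 : (0:ℝ) < (1/2) ^ j := by positivity
        have h6 : ((1/2:ℝ)) ^ j ≤ 1 := pow_le_one₀ (by norm_num) (by norm_num)
        nlinarith
    · push Not at hP
      exact ⟨N, le_rfl, fun k hk _ => hP k hk, fun j hj => by omega⟩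
  obtain ⟨k0, hk0N, hin, hvol⟩ := hex
  refine ⟨k0, hin, ?_⟩
  rw [setAverage_eq, smul_eq_mul, hV, inv_mul_le_iff₀ (by positivity)]
  have hpt : ∀ y ∈ Q, |logF a l N y - k0| =
      ∑ j ∈ Finset.range (N - k0), (cubeSet a (l / 2 ^ (k0 + j))).indicator (fun _ => (1:ℝ)) y := by
    intro y hy
    have e : logF a l N y = k0 + ∑ j ∈ Finset.range (N - k0),
        (cubeSet a (l / 2 ^ (k0 + j))).indicator (fun _ => (1:ℝ)) y := by
      unfold logF
      conv_lhs => rw [← Nat.add_sub_cancel' hk0N]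
      rw [Finset.sum_range_add]
      congr 1
      rw [Finset.sum_congr rfl (g := fun _ => (1:ℝ))]
      · simp
      · intro k hk
        have hk := Finset.mem_range.1 hk
        exact Set.indicator_of_mem (hin k hk (hk.trans_le hk0N) hy) _
    rw [e, add_sub_cancel_left, abs_of_nonneg]
    exact Finset.sum_nonneg fun k _ => Set.indicator_nonneg (fun _ _ => zero_le_one) y
  rw [setIntegral_congr_fun (measurableSet_cubeSet b h) hpt]
  have : Fact (volume Q < ∞) := ⟨hQfin.lt_top⟩
  rw [integral_finset_sum _ fun j _ => (integrable_const (1:ℝ)).indicator (measurableSet_cubeSet _ _)]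
  have hterm : ∀ j ∈ Finset.range (N - k0),
      ∫ y in Q, (cubeSet a (l / 2 ^ (k0 + j))).indicator (fun _ => (1:ℝ)) y ≤ (1/2) ^ j * h ^ d := by
    intro j hj
    rw [integral_indicator (measurableSet_cubeSet _ _), setIntegral_const, smul_eq_mul, mul_one,
      measureReal_restrict_apply (measurableSet_cubeSet _ _), Set.inter_comm]
    exact hvol j (by have := Finset.mem_range.1 hj; omega)
  refine (Finset.sum_le_sum hterm).trans ?_
  rw [← Finset.sum_mul, mul_comm (h ^ d)]
  refine mul_le_mul_of_nonneg_right ?_ (by positivity)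
  have := Summable.sum_le_tsum (Finset.range (N - k0)) (f := fun j : ℕ => (1/2:ℝ) ^ j) (fun j _ => by positivity)
    summable_geometric_two
  rwa [tsum_geometric_two] at this

lemma osc_center {d : ℕ} {Q : Set (Euc d)} (h0 : volume Q ≠ 0) (hfin : volume Q ≠ ∞)
    {f : Euc d → ℝ} (hf : IntegrableOn f Q volume) (c : ℝ) :
    |(⨍ z in Q, f z) - c| ≤ ⨍ y in Q, |f y - c| ∧
    ⨍ y in Q, |f y - ⨍ z in Q, f z| ≤ 2 * ⨍ y in Q, |f y - c| := by
  have hV : 0 < volume.real Q := ENNReal.toReal_pos h0 hfin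
  have : Fact (volume Q < ∞) := ⟨hfin.lt_top⟩
  have hint : ∀ e : ℝ, Integrable (fun y => |f y - e|) (volume.restrict Q) := fun e =>
    (Integrable.sub hf (integrable_const e)).abs
  have h1 : |(⨍ z in Q, f z) - c| ≤ ⨍ y in Q, |f y - c| := by
    have e : (⨍ z in Q, f z) - c = (volume.real Q)⁻¹ * ∫ z in Q, (f z - c) := by
      rw [integral_sub hf (integrable_const c), setIntegral_const, setAverage_eq, smul_eq_mul, smul_eq_mul]
      field_simp
    rw [e, abs_mul, abs_of_pos (inv_pos.2 hV), setAverage_eq, smul_eq_mul]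
    gcongr
    exact abs_integral_le_integral_abs
  refine ⟨h1, ?_⟩
  set m := ⨍ z in Q, f z with hm
  have h2 : ⨍ y in Q, |f y - m| ≤ (⨍ y in Q, |f y - c|) + |m - c| := by
    rw [setAverage_eq, setAverage_eq, smul_eq_mul, smul_eq_mul, inv_mul_le_iff₀ hV, mul_add,
      mul_inv_cancel_left₀ hV.ne']
    calc _ ≤ ∫ y in Q, (|f y - c| + |m - c|) := by
          refine integral_mono (hint m) ((hint c).add (integrable_const _)) fun y => ?_
          have := abs_sub_le (f y) c m
          rw [abs_sub_comm m c]; exact this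
      _ = _ := by
          rw [integral_add (hint c) (integrable_const _), setIntegral_const, smul_eq_mul]
  linarith

lemma logF_sharp {d : ℕ} (a : Fin d → ℝ) {l : ℝ} (hl : 0 < l) (N : ℕ) (x : Euc d) :
    sharpLocal volume (cubeSet a l) (logF a l N) x ≤ ENNReal.ofReal 4 := by
  unfold sharpLocal
  refine iSup₂_le fun Q hQ => ?_
  obtain ⟨⟨b, h, hh, rfl⟩, hx, hsub⟩ := hQ
  refine ENNReal.ofReal_le_ofReal ?_
  have hab : ∀ i, a i ≤ b i := by
    intro i
    have hb : (WithLp.toLp 2 b : Euc d) ∈ cubeSet b h := fun j => ⟨le_rfl, by simp [hh.le]⟩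
    exact (hsub hb i).1
  obtain ⟨k0, -, hk⟩ := logF_osc a hl N b hh hab
  have hfin : volume (cubeSet b h) ≠ ∞ := by rw [volume_cubeSet]; finiteness
  have h0 : volume (cubeSet b h) ≠ 0 := by
    rw [volume_cubeSet]; exact pow_ne_zero _ (ENNReal.ofReal_pos.2 hh).ne'
  have := (osc_center h0 hfin (logF_integrableOn a l N hfin) k0).2
  linarith

lemma logF_mean {d : ℕ} (hd : 0 < d) (a : Fin d → ℝ) {l : ℝ} (hl : 0 < l) {N : ℕ} (hN : 2 ≤ N) :
    ⨍ z in cubeSet a l, logF a l N z ≤ 3 := by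
  obtain ⟨k0, hin, hk⟩ := logF_osc a hl N a hl (fun i => le_rfl)
  have hfin : volume (cubeSet a l) ≠ ∞ := by rw [volume_cubeSet]; finiteness
  have h0 : volume (cubeSet a l) ≠ 0 := by
    rw [volume_cubeSet]; exact pow_ne_zero _ (ENNReal.ofReal_pos.2 hl).ne'
  have h1 := (osc_center h0 hfin (logF_integrableOn a l N hfin) k0).1
  have hk1 : k0 ≤ 1 := by
    by_contra hc
    have hs := hin 1 (by omega) (by omega)
    have hb : (WithLp.toLp 2 (fun i => a i + l) : Euc d) ∈ cubeSet a l := fun j => ⟨by simp [hl.le], by simp⟩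
    have := (hs hb ⟨0, hd⟩).2
    simp at this
    linarith
  have hk2 : (k0:ℝ) ≤ 1 := by exact_mod_cast hk1
  have := le_abs_self ((⨍ z in cubeSet a l, logF a l N z) - k0)
  linarith

lemma logF_rearr {d : ℕ} (hd : 0 < d) (a : Fin d → ℝ) {l : ℝ} (hl : 0 < l) {N : ℕ} (hN : 2 ≤ N) {u : ℝ}
    (hu : u < (l / 2 ^ N) ^ d) :
    ENNReal.ofReal (N - 3) ≤ rearrR (volume.restrict (cubeSet a l))
      (fun x => logF a l N x - ⨍ z in cubeSet a l, logF a l N z) u := by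
  refine le_sInf fun s hs => ?_
  by_contra hc
  push Not at hc
  have hsub : cubeSet a (l / 2 ^ N) ⊆ {x | s < ENNReal.ofReal |logF a l N x - ⨍ z in cubeSet a l, logF a l N z|} ∩ cubeSet a l := by
    intro x hx
    refine ⟨?_, cubeSet_mono a ?_ hx⟩
    · refine hc.trans_le (ENNReal.ofReal_le_ofReal ?_)
      rw [logF_eq a hl N hx]
      have := logF_mean hd a hl hN
      have := le_abs_self ((N:ℝ) - ⨍ z in cubeSet a l, logF a l N z)
      linarith
    · exact div_le_self hl.le (one_le_pow₀ (by norm_num))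
  have h1 := measure_mono (μ := volume) hsub
  rw [← Measure.restrict_apply' (measurableSet_cubeSet a l), volume_cubeSet] at h1
  have h2 := h1.trans hs
  rw [← ENNReal.ofReal_pow (by positivity), ENNReal.ofReal_le_ofReal_iff'] at h2
  have : 0 < (l / 2 ^ N) ^ d := by positivity
  rcases h2 with h2 | h2 <;> linarith

lemma logF_lorentz {d : ℕ} (a : Fin d → ℝ) (l : ℝ) (N : ℕ) {p : ℝ} (hp : 0 < p) {r : ℝ≥0∞}
    (hr : 0 < r) :
    lorentz (volume.restrict (cubeSet a l)) (logF a l N) p r (Ioo 0 1) ≠ ∞ := by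
  have hle : ∀ u, rearrR (volume.restrict (cubeSet a l)) (logF a l N) u ≤ 0 + ENNReal.ofReal N := by
    intro u
    rw [zero_add]
    refine rearr_le ?_
    have : {x | ENNReal.ofReal (N:ℝ) < ENNReal.ofReal |logF a l N x|} = ∅ := by
      ext x
      simp only [Set.mem_setOf_eq, Set.mem_empty_iff_false, iff_false, not_lt]
      rw [abs_of_nonneg (logF_nonneg a l N x)]
      exact ENNReal.ofReal_le_ofReal (logF_le a l N x)
    rw [this]; simp
  have := fin_of_lorentz hp hr (F0 := fun _ => 0) ENNReal.ofReal_ne_top (fun _ _ _ => le_rfl) hle (by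
    unfold qnorm
    split_ifs with h
    · simp
    · have hρ : 0 < r.toReal := ENNReal.toReal_pos hr.ne' h
      simp [ENNReal.zero_rpow_of_pos hρ])
  unfold lorentz
  unfold qint at this
  unfold qnorm
  split_ifs with h
  · simpa [h] using this
  · rw [if_neg h] at this
    exact ENNReal.rpow_ne_top_of_nonneg (by positivity) this

lemma nec_abstract {p C : ℝ} (hp : 0 < p) (hC : 0 < C) {r : ℝ≥0∞} (hr : 0 < r) :
    ∃ D : ℝ, 0 < D ∧ ∀ (F G : ℝ → ℝ≥0∞) (M τ t : ℝ), 0 ≤ M → 0 < τ → 0 < t →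
      (∀ u ∈ Ioo 0 τ, ENNReal.ofReal M ≤ F u) → (∀ u, G u ≤ ENNReal.ofReal 4) →
      qint r (Ioo 0 τ) (fun u => ENNReal.ofReal (u ^ (1 / p)) * F u) ≤
        ENNReal.ofReal C * qint r (Ioo 0 t) (fun u => ENNReal.ofReal (u ^ (1 / p)) * G u) →
      M * τ ^ (1 / p) ≤ D * t ^ (1 / p) := by
  by_cases hrt : r = ∞
  · subst hrt
    refine ⟨4 * C * 2 ^ (1 / p), by positivity, fun F G M τ t hM hτ ht hF hG h => ?_⟩
    simp only [qint, if_true] at h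
    have h1 : ENNReal.ofReal ((τ / 2) ^ (1 / p)) * ENNReal.ofReal M ≤
        ENNReal.ofReal C * (ENNReal.ofReal (t ^ (1 / p)) * ENNReal.ofReal 4) := by
      have hm : τ / 2 ∈ Ioo 0 τ := ⟨by linarith, by linarith⟩
      refine le_trans (mul_le_mul_right (hF _ hm) _) ((le_trans ?_ h).trans ?_)
      · exact le_iSup₂ (f := fun u (_ : u ∈ Ioo (0:ℝ) τ) => ENNReal.ofReal (u ^ (1 / p)) * F u) _ hm
      · refine mul_le_mul_right (iSup₂_le fun u hu => ?_) _
        refine mul_le_mul' (ENNReal.ofReal_le_ofReal ?_) (hG u)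
        exact Real.rpow_le_rpow hu.1.le hu.2.le (by positivity)
    rw [← ENNReal.ofReal_mul (by positivity), ← ENNReal.ofReal_mul (by positivity),
      ← ENNReal.ofReal_mul (by positivity), ENNReal.ofReal_le_ofReal_iff (by positivity),
      Real.div_rpow hτ.le (by norm_num)] at h1
    have h2 : (0:ℝ) < 2 ^ (1 / p) := by positivity
    rw [div_mul_eq_mul_div, div_le_iff₀ h2] at h1
    nlinarith
  · have hρ : 0 < r.toReal := ENNReal.toReal_pos hr.ne' hrt
    set ρ := r.toReal with hρdef
    refine ⟨4 * C ^ (1 / ρ), by positivity, fun F G M τ t hM hτ ht hF hG h => ?_⟩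
    simp only [qint, hrt, if_false, ← hρdef] at h
    set c0 := ∫⁻ u in Ioo (0:ℝ) 1, ENNReal.ofReal (u ^ (1 / p)) ^ ρ / ENNReal.ofReal u with hc0
    have hc1 : c0 ≠ ∞ := wint_ne_top hp hρ
    have hc2 : c0 ≠ 0 := wint_ne_zero p ρ
    have hL : ENNReal.ofReal M ^ ρ * (ENNReal.ofReal (τ ^ (1 / p)) ^ ρ * c0) ≤
        ∫⁻ u in Ioo 0 τ, (ENNReal.ofReal (u ^ (1 / p)) * F u) ^ ρ / ENNReal.ofReal u := by
      rw [← wint_scale p ρ hρ hτ, ← lintegral_const_mul _ (by fun_prop)]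
      refine setLIntegral_mono' measurableSet_Ioo fun u hu => ?_
      rw [ENNReal.mul_rpow_of_nonneg _ _ hρ.le, ← mul_div_assoc, mul_comm]
      gcongr
      exact hF u hu
    have hR : ∫⁻ u in Ioo 0 t, (ENNReal.ofReal (u ^ (1 / p)) * G u) ^ ρ / ENNReal.ofReal u ≤
        ENNReal.ofReal 4 ^ ρ * (ENNReal.ofReal (t ^ (1 / p)) ^ ρ * c0) := by
      rw [← wint_scale p ρ hρ ht, ← lintegral_const_mul _ (by fun_prop)]
      refine setLIntegral_mono' measurableSet_Ioo fun u hu => ?_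
      rw [ENNReal.mul_rpow_of_nonneg _ _ hρ.le, ← mul_div_assoc, mul_comm]
      gcongr
      exact hG u
    have h1 := (hL.trans h).trans (mul_le_mul_right hR _)
    rw [← mul_assoc, ← mul_assoc, ← mul_assoc, ENNReal.mul_le_mul_iff_left hc2 hc1,
      ← ENNReal.mul_rpow_of_nonneg _ _ hρ.le, mul_assoc, ← ENNReal.mul_rpow_of_nonneg _ _ hρ.le,
      show ENNReal.ofReal C = ENNReal.ofReal (C ^ (1 / ρ)) ^ ρ by
        rw [ENNReal.ofReal_rpow_of_nonneg (by positivity) hρ.le, ← Real.rpow_mul hC.le,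
          one_div, inv_mul_cancel₀ hρ.ne', Real.rpow_one],
      ← ENNReal.mul_rpow_of_nonneg _ _ hρ.le, ENNReal.rpow_le_rpow_iff hρ,
      ← ENNReal.ofReal_mul (by positivity), ← ENNReal.ofReal_mul (by positivity),
      ← ENNReal.ofReal_mul (by positivity), ENNReal.ofReal_le_ofReal_iff (by positivity)] at h1
    linarith

lemma growth {θ E : ℝ} (hθ : θ < 1) (h : ∀ N : ℕ, 6 ≤ N → (N:ℝ) - 3 ≤ E * (N:ℝ) ^ θ) : False := by
  have h1 := ((tendsto_rpow_atTop (y := 1 - θ) (by linarith)).comp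
    (tendsto_natCast_atTop_atTop (R := ℝ))).eventually (eventually_gt_atTop (2 * E))
  obtain ⟨N, hN1, hN2⟩ := (h1.and (eventually_ge_atTop 6)).exists
  have h2 := h N hN2
  have h3 : (6:ℝ) ≤ N := by exact_mod_cast hN2
  have h4 : (0:ℝ) < (N:ℝ) ^ θ := by positivity
  have h5 : (N:ℝ) ^ (1 - θ) * (N:ℝ) ^ θ = N := by
    rw [← Real.rpow_add (by linarith)]; simp
  have h6 : 2 * E * (N:ℝ) ^ θ < (N:ℝ) ^ (1 - θ) * (N:ℝ) ^ θ := mul_lt_mul_of_pos_right hN1 h4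
  linarith

lemma necessity {d : ℕ} (hd : 0 < d) {Q0 : Set (Euc d)} (hQ0 : IsCube Q0)
    {p : ℝ} (hp : 0 < p) {r : ℝ≥0∞} (hr : 0 < r) {lam : ℝ} (hlam : 0 < lam)
    (H : ∃ C : ℝ, 0 < C ∧ ∀ f : Euc d → ℝ, Measurable f → IntegrableOn f Q0 volume →
      lorentz (volume.restrict Q0) f p r (Set.Ioo 0 1) ≠ ∞ →
      ∀ t ∈ Set.Ioo (0 : ℝ) 1,
        qint r (Set.Ioo 0 (t * (1 - Real.log t) ^ (-lam)))
            (fun u => ENNReal.ofReal (u ^ (1 / p)) *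
              rearrR (volume.restrict Q0) (fun x => f x - ⨍ z in Q0, f z) u) ≤
          ENNReal.ofReal C *
            qint r (Set.Ioo 0 t)
              (fun u => ENNReal.ofReal (u ^ (1 / p)) *
                rearr (volume.restrict Q0) (sharpLocal volume Q0 f) u)) : p ≤ lam := by
  by_contra hc
  push Not at hc
  obtain ⟨a, l, hl, rfl⟩ := hQ0
  obtain ⟨C, hC, H⟩ := H
  obtain ⟨D, hD, hab⟩ := nec_abstract hp hC hr
  set s : ℝ := min 1 (l ^ d) / 2 with hs
  have hm : 0 < min 1 (l ^ d) := lt_min one_pos (by positivity)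
  have hs0 : 0 < s := by positivity
  have hs1 : s < 1 := by have := min_le_left 1 (l ^ d); linarith
  have hsl : s < l ^ d := by have := min_le_right 1 (l ^ d); linarith
  have hlogs : Real.log s < 0 := Real.log_neg hs0 hs1
  set K : ℝ := 1 - Real.log s + d with hK
  have hK0 : 0 < K := by have : (0:ℝ) ≤ d := by positivity
                         linarith
  refine growth (θ := lam / p) (E := D * K ^ (lam / p)) ((div_lt_one hp).2 hc) fun N hN => ?_
  have hNR : (6:ℝ) ≤ N := by exact_mod_cast hN
  set t : ℝ := s / (2 ^ N) ^ d with ht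
  have ht0 : 0 < t := by positivity
  have hp1 : (1:ℝ) ≤ (2 ^ N) ^ d := one_le_pow₀ (one_le_pow₀ (by norm_num))
  have ht1 : t < 1 := lt_of_le_of_lt (div_le_self hs0.le hp1) hs1
  have hlogt : Real.log t = Real.log s - d * (N * Real.log 2) := by
    rw [ht, Real.log_div hs0.ne' (by positivity), Real.log_pow, Real.log_pow]
  have hlt0 : Real.log t < 0 := Real.log_neg ht0 ht1
  have hKN : 1 - Real.log t ≤ K * N := by
    rw [hlogt, hK]
    have : Real.log 2 ≤ 1 := by have := Real.log_two_lt_d9; linarith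
    have h1 : (d:ℝ) * (N * Real.log 2) ≤ d * N := by
      have : (N:ℝ) * Real.log 2 ≤ N := by nlinarith
      gcongr
    nlinarith
  set L := 1 - Real.log t with hLdef
  have hL1 : 1 ≤ L := by linarith
  have hτ0 : 0 < t * L ^ (-lam) := by positivity
  have hτt : t * L ^ (-lam) ≤ t :=
    mul_le_of_le_one_right ht0.le (Real.rpow_le_one_of_one_le_of_nonpos hL1 (by linarith))
  have htV : t < (l / 2 ^ N) ^ d := by
    rw [div_pow, ht]; gcongr
  have hfin : volume (cubeSet a l) ≠ ∞ := by rw [volume_cubeSet]; finiteness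
  have key := hab _ _ (N - 3) _ t (by linarith) hτ0 ht0
    (fun u hu => logF_rearr hd a hl (by omega) (lt_trans hu.2 (hτt.trans_lt htV)))
    (fun u => rearr_le (by
      have : {x | ENNReal.ofReal 4 < sharpLocal volume (cubeSet a l) (logF a l N) x} = ∅ := by
        ext x
        simp only [Set.mem_setOf_eq, Set.mem_empty_iff_false, iff_false, not_lt]
        exact logF_sharp a hl N x
      rw [this]; simp))
    (H (logF a l N) (logF_measurable a l N) (logF_integrableOn a l N hfin)
      (logF_lorentz a l N hp hr) t ⟨ht0, ht1⟩)
  rw [Real.mul_rpow ht0.le (by positivity), ← Real.rpow_mul (by linarith)] at key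
  have htp : 0 < t ^ (1 / p) := by positivity
  have key2 : ((N:ℝ) - 3) * L ^ (-lam * (1 / p)) ≤ D := by
    refine le_of_mul_le_mul_right ?_ htp
    linarith
  rw [show -lam * (1 / p) = -(lam / p) by ring, Real.rpow_neg (by linarith),
    ← div_eq_mul_inv, div_le_iff₀ (by positivity)] at key2
  refine key2.trans ?_
  rw [mul_assoc, ← Real.mul_rpow hK0.le (by linarith)]
  gcongr

/-- Optimality of the logarithmic shift in the Bennett–DeVore–Sharpley type
inequality: the inequality with shift `(1 - log t)^{-λ}` holds with a constant
independent of `f` and `t` if and only if `λ ≥ p` (Theorem 1.9, (1.23)). -/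
theorem statement8 (d : ℕ) (hd : 0 < d) (Q0 : Set (Euc d)) (hQ0 : IsCube Q0)
    (p : ℝ) (hp : 1 < p) (r : ℝ≥0∞) (hr : 0 < r) (lam : ℝ) (hlam : 0 < lam) :
    (∃ C : ℝ, 0 < C ∧ ∀ f : Euc d → ℝ, Measurable f → IntegrableOn f Q0 volume →
      lorentz (volume.restrict Q0) f p r (Set.Ioo 0 1) ≠ ∞ →
      ∀ t ∈ Set.Ioo (0 : ℝ) 1,
        qint r (Set.Ioo 0 (t * (1 - Real.log t) ^ (-lam)))
            (fun u => ENNReal.ofReal (u ^ (1 / p)) *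
              rearrR (volume.restrict Q0) (fun x => f x - ⨍ z in Q0, f z) u) ≤
          ENNReal.ofReal C *
            qint r (Set.Ioo 0 t)
              (fun u => ENNReal.ofReal (u ^ (1 / p)) *
                rearr (volume.restrict Q0) (sharpLocal volume Q0 f) u)) ↔
      p ≤ lam := by
  constructor
  · exact necessity hd hQ0 (by linarith) hr hlam
  · exact fun h => sufficiency hQ0 (by linarith) hr h

end
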